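/- arXiv:1404.4063 — 8 statements merged into one kernel-verified Lean document; each statement's English description precedes it below -/
import Mathlib

section
/- Assume that the differences {a − a′ : a, a′ ∈ A} generate ℤ^m as a group. Then the dual toric code C_A*(𝔽_q) has minimum distance exactly 3 if and only if there exist three distinct points α, β, γ ∈ (𝔽_q^*)^m whose evaluation vectors (α^a)_{a∈A}, (β^a)_{a∈A}, (γ^a)_{a∈A} are linearly dependent over 𝔽_q (i.e. three collinear 𝔽_q-points on the associated toric variety). -/
/-- The toric code: image of the evaluation map sending a coefficient vector
`c : A → 𝔽` to the function `(𝔽ˣ)^m → 𝔽`, `α ↦ ∑_{a ∈ A} c a · α^a`. -/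
def toricCode (F : Type) [Field F] (m : ℕ) (A : Finset (Fin m → ℕ)) :
    Set ((Fin m → Fˣ) → F) :=
  {w | ∃ c : (Fin m → ℕ) → F, ∀ α : Fin m → Fˣ, w α = ∑ a ∈ A, c a * ∏ i, (α i : F) ^ a i}

open Classical in
/-- The dual toric code: functionals `y` with `∑_α y α · w α = 0` for all words `w`. -/
noncomputable def dualToricCode (F : Type) [Field F] [Fintype F] (m : ℕ)
    (A : Finset (Fin m → ℕ)) : Set ((Fin m → Fˣ) → F) :=
  {y | ∀ w ∈ toricCode F m A, ∑ α : Fin m → Fˣ, y α * w α = 0}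

/-- The weight of a word: the cardinality of its support. -/
noncomputable def wt {m : ℕ} {F : Type} [Field F] (y : (Fin m → Fˣ) → F) : ℕ :=
  (Function.support y).ncard

/-- The minimum distance of a code: least weight of a nonzero word. -/
noncomputable def dmin {m : ℕ} {F : Type} [Field F] (C : Set ((Fin m → Fˣ) → F)) : ℕ :=
  sInf {k | ∃ y ∈ C, y ≠ 0 ∧ wt y = k}

/-- A character of the torus lattice that is constant on `A` is trivial when the differences of
`A` generate the lattice. -/
theorem eq_one_of_monomial_const {F : Type} [Field F] {m : ℕ} {A : Finset (Fin m → ℕ)}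
    (hgen : AddSubgroup.closure
        {v : Fin m → ℤ | ∃ a ∈ A, ∃ b ∈ A, v = fun i => (a i : ℤ) - (b i : ℤ)} = ⊤)
    (τ : Fin m → Fˣ) (hτ : ∀ a ∈ A, ∀ b ∈ A, ∏ i, τ i ^ a i = ∏ i, τ i ^ b i) :
    τ = 1 := by
  have key : ∀ v : Fin m → ℤ, ∏ i, τ i ^ v i = 1 := by
    intro v
    have hv : v ∈ AddSubgroup.closure
        {v : Fin m → ℤ | ∃ a ∈ A, ∃ b ∈ A, v = fun i => (a i : ℤ) - (b i : ℤ)} := by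
      rw [hgen]; trivial
    induction hv using AddSubgroup.closure_induction with
    | mem x hx =>
      obtain ⟨a, ha, b, hb, rfl⟩ := hx
      simp [zpow_sub, Finset.prod_mul_distrib, hτ a ha b hb]
    | zero => simp
    | add x y _ _ hx hy => simp [zpow_add, Finset.prod_mul_distrib, hx, hy]
    | neg x _ hx => simp [zpow_neg, hx]
  funext i
  have h := key (Pi.single i 1)
  rw [Finset.prod_eq_single i] at h
  · simpa using h
  · intro j _ hj
    simp [hj]
  · simp

/-- Evaluation vectors at two distinct points of the torus are linearly independent. -/
theorem eq_of_two_dependent {F : Type} [Field F] {m : ℕ} {A : Finset (Fin m → ℕ)}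
    (hgen : AddSubgroup.closure
        {v : Fin m → ℤ | ∃ a ∈ A, ∃ b ∈ A, v = fun i => (a i : ℤ) - (b i : ℤ)} = ⊤)
    {α β : Fin m → Fˣ} {c d : F} (hc : c ≠ 0)
    (h : ∀ a ∈ A, c * ∏ i, (α i : F) ^ a i + d * ∏ i, (β i : F) ^ a i = 0) : α = β := by
  have hratio : ∀ a ∈ A, ((∏ i, (α / β) i ^ a i : Fˣ) : F) = -d / c := by
    intro a ha
    have hβ : ∏ i, (β i : F) ^ a i ≠ 0 :=
      Finset.prod_ne_zero_iff.mpr fun i _ => pow_ne_zero _ (β i).ne_zero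
    have := h a ha
    simp only [Pi.div_apply, div_pow, Finset.prod_div_distrib, Units.val_div_eq_div_val,
      Units.coe_prod, Units.val_pow_eq_pow_val]
    rw [div_eq_div_iff hβ hc]
    linear_combination this
  exact div_eq_one.mp (eq_one_of_monomial_const hgen (α / β) fun a ha b hb =>
    Units.ext ((hratio a ha).trans (hratio b hb).symm))

theorem mem_dualToricCode_iff {F : Type} [Field F] [Fintype F] {m : ℕ}
    {A : Finset (Fin m → ℕ)} {s : Finset (Fin m → Fˣ)} {y : (Fin m → Fˣ) → F}
    (hs : Function.support y ⊆ s) :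
    y ∈ dualToricCode F m A ↔ ∀ a ∈ A, ∑ α ∈ s, y α * ∏ i, (α i : F) ^ a i = 0 := by
  classical
  have hsum (w : (Fin m → Fˣ) → F) : ∑ α, y α * w α = ∑ α ∈ s, y α * w α := by
    refine (Finset.sum_subset s.subset_univ fun α _ hα => ?_).symm
    rw [Function.notMem_support.mp fun h => hα (hs h), zero_mul]
  constructor
  · intro hy a ha
    rw [← hsum fun α => ∏ i, (α i : F) ^ a i]
    convert hy (fun α => ∏ i, (α i : F) ^ a i) ⟨Pi.single a 1, fun α => ?_⟩
    rw [Finset.sum_eq_single a]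
    · simp
    · intro b _ hb
      simp [hb]
    · exact fun h => absurd ha h
  · rintro h w ⟨c, hw⟩
    have : ∑ α, y α * w α = 0 := by
      rw [hsum]
      simp_rw [hw, Finset.mul_sum]
      rw [Finset.sum_comm]
      refine Finset.sum_eq_zero fun a ha => ?_
      simp_rw [mul_left_comm _ (c a)]
      rw [← Finset.mul_sum, h a ha, mul_zero]
    convert this

theorem three_le_wt {F : Type} [Field F] [Fintype F] {m : ℕ} {A : Finset (Fin m → ℕ)}
    (hgen : AddSubgroup.closure
        {v : Fin m → ℤ | ∃ a ∈ A, ∃ b ∈ A, v = fun i => (a i : ℤ) - (b i : ℤ)} = ⊤)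
    (hA : A.Nonempty) {y : (Fin m → Fˣ) → F} (hy : y ∈ dualToricCode F m A) (hy0 : y ≠ 0) :
    3 ≤ wt y := by
  classical
  by_contra! hlt
  have hpos : wt y ≠ 0 := by
    rw [wt, Ne, Set.ncard_eq_zero]
    exact (Function.support_nonempty_iff.mpr hy0).ne_empty
  have hcases : wt y = 1 ∨ wt y = 2 := by omega
  rcases hcases with h1 | h2
  · obtain ⟨α, hα⟩ := Set.ncard_eq_one.mp h1
    have hyα : y α ≠ 0 := by
      rw [← Function.mem_support, hα]; simp
    obtain ⟨a, ha⟩ := hA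
    have h := (mem_dualToricCode_iff (s := {α}) (by simp [hα])).mp hy a ha
    rw [Finset.sum_singleton] at h
    exact mul_ne_zero hyα
      (Finset.prod_ne_zero_iff.mpr fun i _ => pow_ne_zero _ (α i).ne_zero) h
  · obtain ⟨α, β, hαβ, hsupp⟩ := Set.ncard_eq_two.mp h2
    have hyα : y α ≠ 0 := by
      rw [← Function.mem_support, hsupp]; simp
    have h := (mem_dualToricCode_iff (s := {α, β}) (by simp [hsupp])).mp hy
    simp only [Finset.sum_pair hαβ] at h
    exact hαβ (eq_of_two_dependent hgen hyα h)

/-- If the differences of `A` generate `ℤ^m`, the dual toric code has minimum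
distance exactly `3` iff there are three distinct points of the torus whose evaluation
vectors are linearly dependent over `𝔽_q`. -/
theorem stmt5 (F : Type) [Field F] [Fintype F] (m : ℕ) (A : Finset (Fin m → ℕ))
    (hgen : AddSubgroup.closure
        {v : Fin m → ℤ | ∃ a ∈ A, ∃ b ∈ A, v = fun i => (a i : ℤ) - (b i : ℤ)} = ⊤) :
    dmin (dualToricCode F m A) = 3 ↔
      ∃ α β γ : Fin m → Fˣ, α ≠ β ∧ α ≠ γ ∧ β ≠ γ ∧
        ∃ c₁ c₂ c₃ : F, ¬(c₁ = 0 ∧ c₂ = 0 ∧ c₃ = 0) ∧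
          ∀ a ∈ A, c₁ * ∏ i, (α i : F) ^ a i + c₂ * ∏ i, (β i : F) ^ a i
              + c₃ * ∏ i, (γ i : F) ^ a i = 0 := by
  classical
  constructor
  · intro hd
    have hne : {k | ∃ y ∈ dualToricCode F m A, y ≠ 0 ∧ wt y = k}.Nonempty := by
      apply Nat.nonempty_of_pos_sInf
      change 0 < dmin (dualToricCode F m A)
      omega
    obtain ⟨y, hy, hy0, hwt⟩ := Nat.sInf_mem hne
    obtain ⟨α, β, γ, hαβ, hαγ, hβγ, hsupp⟩ := Set.ncard_eq_three.mp (hwt.trans hd)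
    have hyα : y α ≠ 0 := by
      rw [← Function.mem_support, hsupp]; simp
    refine ⟨α, β, γ, hαβ, hαγ, hβγ, y α, y β, y γ, fun h => hyα h.1, fun a ha => ?_⟩
    have h := (mem_dualToricCode_iff (s := {α, β, γ}) (by simp [hsupp])).mp hy a ha
    rwa [Finset.sum_insert (by simp [hαβ, hαγ]), Finset.sum_pair hβγ, ← add_assoc] at h
  · rintro ⟨α, β, γ, hαβ, hαγ, hβγ, c₁, c₂, c₃, hc, h⟩
    have hA : A.Nonempty := by
      rw [Finset.nonempty_iff_ne_empty]
      rintro rfl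
      exact hαβ (eq_of_two_dependent (c := 1) (d := 0) hgen one_ne_zero (by simp))
    let y : (Fin m → Fˣ) → F := Pi.single α c₁ + Pi.single β c₂ + Pi.single γ c₃
    have hyα : y α = c₁ := by simp [y, hαβ, hαγ]
    have hyβ : y β = c₂ := by simp [y, hαβ.symm, hβγ]
    have hyγ : y γ = c₃ := by simp [y, hαγ.symm, hβγ.symm]
    have hsupp : Function.support y ⊆ (({α, β, γ} : Finset (Fin m → Fˣ)) : Set _) := by
      intro δ hδ
      by_contra hn
      simp only [Finset.coe_insert, Finset.coe_singleton, Set.mem_insert_iff,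
        Set.mem_singleton_iff, not_or] at hn
      exact hδ (by simp [y, hn])
    have hmem : y ∈ dualToricCode F m A := by
      refine (mem_dualToricCode_iff hsupp).mpr fun a ha => ?_
      rw [Finset.sum_insert (by simp [hαβ, hαγ]), Finset.sum_pair hβγ, hyα, hyβ, hyγ, ← add_assoc]
      exact h a ha
    have hy0 : y ≠ 0 := by
      intro h0
      exact hc ⟨by rw [← hyα, h0]; rfl, by rw [← hyβ, h0]; rfl, by rw [← hyγ, h0]; rfl⟩
    have hle : wt y ≤ 3 := by
      refine (Set.ncard_le_ncard hsupp (Finset.finite_toSet _)).trans ?_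
      rw [Set.ncard_coe_finset]
      exact Finset.card_le_three
    have hwt : wt y = 3 := le_antisymm hle (three_le_wt hgen hA hmem hy0)
    refine IsLeast.csInf_eq ⟨⟨y, hmem, hy0, hwt⟩, ?_⟩
    rintro k ⟨z, hz, hz0, rfl⟩
    exact three_le_wt hgen hA hz hz0
end

section
/- Assume that the differences {a − a′ : a, a′ ∈ A} generate ℤ^m as a group and that |A| ≥ m + 2; set c := |A| − 1 − m (the codimension of the associated toric variety). Then for every prime p there exists a positive integer k such that for every positive integer n divisible by k, the dual toric code C_A*(𝔽_{p^n}) contains a nonzero word of weight at most c + 3; in particular dmin(C_A*(𝔽_{p^n})) ≤ c + 3 for all fields in this cofinal family of finite fields of characteristic p. -/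
/-- Fewer than `m + 1` lattice points of `ℤ^m` lie on a common hyperplane. -/
theorem exists_ne_zero_dotProduct_const {m : ℕ} [NeZero m] (b : Fin m → Fin m → ℕ) :
    ∃ u : Fin m → ℤ, u ≠ 0 ∧ ∀ i, ∑ j, u j * (b i j : ℤ) = ∑ j, u j * (b 0 j : ℤ) := by
  obtain ⟨u, hu, h⟩ := (Matrix.exists_mulVec_eq_zero_iff
    (M := Matrix.of fun i j => (b i j : ℤ) - (b 0 j : ℤ))).mpr
    (Matrix.det_eq_zero_of_row_eq_zero 0 (by simp))
  refine ⟨u, hu, fun i => ?_⟩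
  have hi := congrFun h i
  simp only [Matrix.mulVec, dotProduct, Matrix.of_apply, Pi.zero_apply, sub_mul,
    Finset.sum_sub_distrib, sub_eq_zero] at hi
  simpa only [mul_comm] using hi

/-- A finite set of at least `m` exponents has a nonzero integral linear form that is constant
on `m` of its elements. -/
theorem exists_ne_zero_card_image_le {m : ℕ} (hm : m ≠ 0) (A : Finset (Fin m → ℕ))
    (hA : m ≤ A.card) :
    ∃ u : Fin m → ℤ, u ≠ 0 ∧
      (A.image fun a => ∑ j, u j * (a j : ℤ)).card ≤ A.card - m + 1 := by
  classical
  have : NeZero m := ⟨hm⟩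
  obtain ⟨B, hBA, hB⟩ := Finset.exists_subset_card_eq hA
  let e := (B.equivFinOfCardEq hB).symm
  obtain ⟨u, hu, h⟩ := exists_ne_zero_dotProduct_const fun i => (e i : Fin m → ℕ)
  refine ⟨u, hu, ?_⟩
  set f : (Fin m → ℕ) → ℤ := fun a => ∑ j, u j * (a j : ℤ) with hf
  have hsub : A.image f ⊆ insert (f (e 0)) ((A \ B).image f) := by
    intro x hx
    obtain ⟨a, ha, rfl⟩ := Finset.mem_image.mp hx
    by_cases hab : a ∈ B
    · have := h (e.symm ⟨a, hab⟩)
      simp only [Equiv.apply_symm_apply] at this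
      exact Finset.mem_insert.mpr (Or.inl this)
    · exact Finset.mem_insert_of_mem
        (Finset.mem_image_of_mem f (Finset.mem_sdiff.mpr ⟨ha, hab⟩))
  calc (A.image f).card ≤ _ := Finset.card_le_card hsub
    _ ≤ ((A \ B).image f).card + 1 := Finset.card_insert_le _ _
    _ ≤ (A \ B).card + 1 := by gcongr; exact Finset.card_image_le
    _ = A.card - m + 1 := by rw [Finset.card_sdiff_of_subset hBA, hB]

/-- A linear relation among the evaluations of the monomials of `A` at distinct points of the torus
is a word of the dual toric code. -/
theorem exists_mem_dualToricCode {F : Type} [Field F] [Fintype F] {m r : ℕ}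
    {A : Finset (Fin m → ℕ)} {P : Fin r → Fin m → Fˣ} (hP : Function.Injective P)
    {v : Fin r → F} (hv : v ≠ 0)
    (h : ∀ a ∈ A, ∑ s, v s * ∏ i, (P s i : F) ^ a i = 0) :
    ∃ y ∈ dualToricCode F m A, y ≠ 0 ∧ wt y ≤ r := by
  classical
  refine ⟨Function.extend P v 0, ?_, ?_, ?_⟩
  · rintro w ⟨c, hw⟩
    have hsum : ∑ α, Function.extend P v 0 α * w α = ∑ s, v s * w (P s) := by
      rw [← Finset.sum_subset (Finset.subset_univ (Finset.univ.image P)),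
        Finset.sum_image hP.injOn]
      · simp [hP.extend_apply]
      · intro α _ hα
        rw [Function.extend_apply', Pi.zero_apply, zero_mul]
        rintro ⟨s, rfl⟩
        exact hα (Finset.mem_image_of_mem P (Finset.mem_univ s))
    have hgoal : ∑ α, Function.extend P v 0 α * w α = 0 := by
      simp_rw [hsum, hw, Finset.mul_sum]
      rw [Finset.sum_comm]
      refine Finset.sum_eq_zero fun a ha => ?_
      simp_rw [mul_left_comm _ (c a), ← Finset.mul_sum]
      rw [h a ha, mul_zero]
    convert hgoal
  · intro h0
    refine hv (funext fun s => ?_)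
    rw [← hP.extend_apply v 0 s, h0]
    rfl
  · have hsub : Function.support (Function.extend P v 0) ⊆ Set.range P := by
      intro α hα
      by_contra hn
      exact hα (Function.extend_apply' _ _ _ hn)
    calc wt (Function.extend P v 0) ≤ (Set.range P).ncard :=
          Set.ncard_le_ncard hsub (Set.finite_range P)
      _ = r := by rw [← Set.image_univ, Set.ncard_image_of_injective _ hP, Set.ncard_univ,
          Nat.card_fin]

/-- Points `g ^ (s • u)` of a one-parameter subgroup are distinct for small `s`. -/
theorem injective_zpow_mul {G : Type*} [Group G] {m r : ℕ} {g : G} {u : Fin m → ℤ} {i : Fin m}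
    (hi : u i ≠ 0) (hg : r * (u i).natAbs < orderOf g) :
    Function.Injective fun (s : Fin (r + 1)) (j : Fin m) => (g ^ (s : ℕ)) ^ u j := by
  intro s t hst
  have h := congrFun hst i
  simp only [← zpow_natCast, ← zpow_mul] at h
  rw [zpow_eq_zpow_iff_modEq, Int.modEq_iff_dvd, ← sub_mul] at h
  have hzero := Int.eq_zero_of_abs_lt_dvd h (by
    rw [abs_mul, Int.abs_eq_natAbs (u i)]
    have hst' : |((t : ℕ) : ℤ) - ((s : ℕ) : ℤ)| ≤ r := by
      rw [abs_le]; omega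
    calc _ ≤ (r : ℤ) * (u i).natAbs := by gcongr
      _ < orderOf g := by exact_mod_cast hg)
  have := (mul_eq_zero.mp hzero).resolve_right hi
  exact Fin.ext (by omega)

/-- If the differences of `A` generate `ℤ^m` and `|A| ≥ m + 2`, with
`c := |A| − 1 − m`, then for every prime `p` there is `k > 0` such that for every `n > 0`
divisible by `k`, the dual toric code over the field `𝔽_{p^n}` contains a nonzero word of
weight at most `c + 3`. -/
theorem stmt6 (m : ℕ) (A : Finset (Fin m → ℕ))
    (hgen : AddSubgroup.closure
        {v : Fin m → ℤ | ∃ a ∈ A, ∃ b ∈ A, v = fun i => (a i : ℤ) - (b i : ℤ)} = ⊤)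
    (hcard : m + 2 ≤ A.card) (p : ℕ) (hp : p.Prime) :
    ∃ k : ℕ, 0 < k ∧ ∀ n : ℕ, 0 < n → k ∣ n →
      ∀ (F : Type) [Field F] [Fintype F], Fintype.card F = p ^ n →
        ∃ y ∈ dualToricCode F m A, y ≠ 0 ∧ wt y ≤ (A.card - 1 - m) + 3 := by
  classical
  have hm : m ≠ 0 := by
    rintro rfl
    have := Finset.card_le_one_of_subsingleton A
    omega
  obtain ⟨u, hu, hV⟩ := exists_ne_zero_card_image_le hm A (by omega)
  obtain ⟨i, hi⟩ := Function.ne_iff.mp hu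
  set r := (A.card - 1 - m) + 2 with hr
  refine ⟨r * (u i).natAbs + 1, by omega, fun n hn hkn F _ _ hF => ?_⟩
  obtain ⟨g, hg⟩ := IsCyclic.exists_generator (α := Fˣ)
  have hord : r * (u i).natAbs < orderOf g := by
    rw [orderOf_eq_card_of_forall_mem_zpowers hg, Nat.card_eq_fintype_card,
      Fintype.card_units, hF]
    have h1 := Nat.le_of_dvd hn hkn
    have h2 := Nat.lt_pow_self (n := n) hp.one_lt
    omega
  set V := A.image fun a => ∑ j, u j * (a j : ℤ) with hVdef
  let M : Matrix V (Fin (r + 1)) F := Matrix.of fun d s => (((g ^ (s : ℕ)) ^ (d : ℤ) : Fˣ) : F)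
  have hker : LinearMap.ker M.mulVecLin ≠ ⊥ := by
    apply LinearMap.ker_ne_bot_of_finrank_lt
    rw [Module.finrank_fintype_fun_eq_card, Module.finrank_fintype_fun_eq_card,
      Fintype.card_coe, Fintype.card_fin]
    omega
  obtain ⟨v, hv, hv0⟩ := Submodule.exists_mem_ne_zero_of_ne_bot hker
  refine exists_mem_dualToricCode (injective_zpow_mul hi hord) hv0 fun a ha => ?_
  have h := congrFun (LinearMap.mem_ker.mp hv)
    ⟨∑ j, u j * (a j : ℤ), Finset.mem_image_of_mem _ ha⟩
  simp only [Matrix.mulVecLin_apply, Matrix.mulVec, dotProduct, M, Matrix.of_apply,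
    Pi.zero_apply] at h
  rw [← h]
  refine Finset.sum_congr rfl fun s _ => ?_
  rw [mul_comm]
  congr 1
  have key : ∏ j, ((g ^ (s : ℕ)) ^ u j) ^ a j = (g ^ (s : ℕ)) ^ ∑ j, u j * (a j : ℤ) := by
    simp_rw [← zpow_natCast _ (a _), ← zpow_mul]
    exact (map_sum (zmultiplesHom (Additive Fˣ) (Additive.ofMul (g ^ (s : ℕ)))) _ _).symm
  rw [← key]
  simp only [Units.coe_prod, Units.val_pow_eq_pow_val]
end

section
/- Let A = {(0,0), (1,0), (0,1), (2,0), (1,1), (0,2)} ⊆ ℤ² (the lattice points of the exceptional simplex Δ₂ = Conv((0,0),(2,0),(0,2))). Then for every prime power q ≥ 5, the dual toric code C_A*(𝔽_q) has minimum distance exactly 4. -/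
/-- A word is orthogonal to the toric code of degree-two plane polynomials exactly when it is
orthogonal to every combination of the six monomials. -/
theorem mem_dualToricCode_two_iff (F : Type) [Field F] [Fintype F] [Fintype (Fin 2 → Fˣ)]
    (y : (Fin 2 → Fˣ) → F) :
    y ∈ dualToricCode F 2
        ({![0,0], ![1,0], ![0,1], ![2,0], ![1,1], ![0,2]} : Finset (Fin 2 → ℕ)) ↔
      ∀ c₁ c₂ c₃ c₄ c₅ c₆ : F, ∑ α : Fin 2 → Fˣ, y α * (c₁ + c₂ * α 0 + c₃ * α 1 +
        c₄ * (α 0 : F) ^ 2 + c₅ * (α 0 * α 1) + c₆ * (α 1 : F) ^ 2) = 0 := by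
  have key (c : (Fin 2 → ℕ) → F) (α : Fin 2 → Fˣ) :
      ∑ a ∈ ({![0,0], ![1,0], ![0,1], ![2,0], ![1,1], ![0,2]} : Finset (Fin 2 → ℕ)),
        c a * ∏ i, (α i : F) ^ a i =
      c ![0,0] + c ![1,0] * α 0 + c ![0,1] * α 1 + c ![2,0] * (α 0 : F) ^ 2 +
        c ![1,1] * (α 0 * α 1) + c ![0,2] * (α 1 : F) ^ 2 := by
    rw [Finset.sum_insert (by decide), Finset.sum_insert (by decide),
      Finset.sum_insert (by decide), Finset.sum_insert (by decide),
      Finset.sum_insert (by decide), Finset.sum_singleton]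
    simp [Fin.prod_univ_two]
    ring
  constructor
  · intro h c₁ c₂ c₃ c₄ c₅ c₆
    have h' := h _ ⟨fun a => if a = ![0,0] then c₁ else if a = ![1,0] then c₂ else
      if a = ![0,1] then c₃ else if a = ![2,0] then c₄ else if a = ![1,1] then c₅ else c₆,
      fun α => rfl⟩
    simp only [key] at h'
    convert h' using 4 <;> simp
  · rintro h w ⟨c, hc⟩
    convert h (c ![0,0]) (c ![1,0]) (c ![0,1]) (c ![2,0]) (c ![1,1]) (c ![0,2]) using 3
    rw [hc, key]

/-- A nonzero word orthogonal to all plane polynomials of degree two has weight at least four: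
two lines separate any point from two others. -/
theorem four_le_wt_of_orthogonal {F : Type} [Field F] [Fintype (Fin 2 → Fˣ)] [Nontrivial Fˣ]
    {y : (Fin 2 → Fˣ) → F}
    (h : ∀ c₁ c₂ c₃ c₄ c₅ c₆ : F, ∑ α : Fin 2 → Fˣ, y α * (c₁ + c₂ * α 0 + c₃ * α 1 +
        c₄ * (α 0 : F) ^ 2 + c₅ * (α 0 * α 1) + c₆ * (α 1 : F) ^ 2) = 0)
    (hy : y ≠ 0) : 4 ≤ wt y := by
  classical
  by_contra! hlt
  obtain ⟨p, hp⟩ := Function.ne_iff.mp hy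
  have lines (i j : Fin 2) (c d : F) :
      ∑ α : Fin 2 → Fˣ, y α * (((α i : F) - c) * ((α j : F) - d)) = 0 := by
    fin_cases i <;> fin_cases j
    · rw [← h (c * d) (-c - d) 0 1 0 0]
      refine Finset.sum_congr rfl fun α _ => ?_
      simp only [Fin.zero_eta]; ring
    · rw [← h (c * d) (-d) (-c) 0 1 0]
      refine Finset.sum_congr rfl fun α _ => ?_
      simp only [Fin.zero_eta, Fin.mk_one]; ring
    · rw [← h (c * d) (-c) (-d) 0 1 0]
      refine Finset.sum_congr rfl fun α _ => ?_
      simp only [Fin.zero_eta, Fin.mk_one]; ring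
    · rw [← h (c * d) 0 (-c - d) 0 0 1]
      refine Finset.sum_congr rfl fun α _ => ?_
      simp only [Fin.mk_one]; ring
  have separate (q r : Fin 2 → Fˣ) (hq : q ≠ p) (hr : r ≠ p)
      (hs : ∀ α, α ≠ p → α ≠ q → α ≠ r → y α = 0) : False := by
    obtain ⟨i, hi⟩ := Function.ne_iff.mp hq
    obtain ⟨j, hj⟩ := Function.ne_iff.mp hr
    have hl := lines i j (q i) (r j)
    rw [Finset.sum_eq_single p] at hl
    · simp only [mul_eq_zero, sub_eq_zero, Units.val_inj] at hl
      rcases hl with hl | hl | hl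
      exacts [hp hl, hi hl.symm, hj hl.symm]
    · intro α _ hα
      by_cases hαq : α = q
      · simp [hαq]
      by_cases hαr : α = r
      · simp [hαr]
      simp [hs α hα hαq hαr]
    · simp
  set T : Finset (Fin 2 → Fˣ) := (Finset.univ.filter fun α => y α ≠ 0).erase p with hT
  have hmem (α : Fin 2 → Fˣ) (hα : α ≠ p) (hαT : α ∉ T) : y α = 0 := by
    by_contra hne
    exact hαT (by simp [hT, hα, hne])
  have hpT : p ∉ T := by simp [hT]
  have hcard : T.card < 3 := by
    have hw : wt y = (Finset.univ.filter fun α => y α ≠ 0).card := by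
      rw [wt, ← Set.ncard_coe_finset]
      congr 1
      ext α
      simp
    have := Finset.card_erase_add_one (s := Finset.univ.filter fun α => y α ≠ 0) (a := p)
      (by simpa using hp)
    rw [← hT] at this
    omega
  interval_cases hc : T.card
  · obtain ⟨q, hq⟩ := exists_ne p
    rw [Finset.card_eq_zero] at hc
    exact separate q q hq hq fun α h₁ _ _ => hmem α h₁ (by simp [hc])
  · obtain ⟨q, hq⟩ := Finset.card_eq_one.mp hc
    have hqp : q ≠ p := by rintro rfl; simp [hq] at hpT
    exact separate q q hqp hqp fun α h₁ h₂ _ => hmem α h₁ (by simp [hq, h₂])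
  · obtain ⟨q, r, -, hqr⟩ := Finset.card_eq_two.mp hc
    have hqp : q ≠ p := by rintro rfl; simp [hqr] at hpT
    have hrp : r ≠ p := by rintro rfl; simp [hqr] at hpT
    exact separate q r hqp hrp fun α h₁ h₂ h₃ => hmem α h₁ (by simp [hqr, h₂, h₃])

/-- Lagrange weights at four distinct nodes annihilate all polynomials of degree at most two. -/
theorem exists_weights_annihilating_quadratics {F : Type} [Field F] {t : Fin 4 → F}
    (ht : Function.Injective t) :
    ∃ w : Fin 4 → F, (∀ i, w i ≠ 0) ∧
      ∀ a b c : F, ∑ i, w i * (a + b * t i + c * t i ^ 2) = 0 := by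
  have hne {i j : Fin 4} (hij : i ≠ j) : t i - t j ≠ 0 := sub_ne_zero.mpr (ht.ne hij)
  have h01 := hne (show (0 : Fin 4) ≠ 1 by decide)
  have h02 := hne (show (0 : Fin 4) ≠ 2 by decide)
  have h03 := hne (show (0 : Fin 4) ≠ 3 by decide)
  have h12 := hne (show (1 : Fin 4) ≠ 2 by decide)
  have h13 := hne (show (1 : Fin 4) ≠ 3 by decide)
  have h23 := hne (show (2 : Fin 4) ≠ 3 by decide)
  refine ⟨![(t 1 - t 2) * (t 1 - t 3) * (t 2 - t 3), -((t 0 - t 2) * (t 0 - t 3) * (t 2 - t 3)),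
    (t 0 - t 1) * (t 0 - t 3) * (t 1 - t 3), -((t 0 - t 1) * (t 0 - t 2) * (t 1 - t 2))],
    fun i => ?_, fun a b c => ?_⟩
  · fin_cases i <;> simp [*]
  · simp [Fin.sum_univ_four]
    ring

/-- For `A` the six lattice points of the exceptional simplex
`Δ₂ = Conv((0,0),(2,0),(0,2))` and every finite field with `q ≥ 5` elements, the dual
toric code has minimum distance exactly `4`. -/
theorem stmt8 (F : Type) [Field F] [Fintype F] (hq : 5 ≤ Fintype.card F) :
    dmin (dualToricCode F 2
        ({![0,0], ![1,0], ![0,1], ![2,0], ![1,1], ![0,2]} : Finset (Fin 2 → ℕ))) = 4 := by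
  classical
  have hunits : 4 ≤ Fintype.card Fˣ := by
    rw [Fintype.card_units]; omega
  have : Nontrivial Fˣ := Fintype.one_lt_card_iff_nontrivial.mp (by omega)
  obtain ⟨t⟩ : Nonempty (Fin 4 ↪ Fˣ) :=
    Function.Embedding.nonempty_of_card_le (by simpa using hunits)
  obtain ⟨w, hw, hsum⟩ := exists_weights_annihilating_quadratics
    (t := fun i => (t i : F)) (Units.val_injective.comp t.injective)
  set P : Fin 4 → Fin 2 → Fˣ := fun i => ![t i, 1] with hP
  have hPinj : Function.Injective P := fun i j hij => t.injective (congrFun hij 0)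
  set y : (Fin 2 → Fˣ) → F := fun α => ∑ i, if α = P i then w i else 0 with hydef
  have hyP (i : Fin 4) : y (P i) = w i := by simp [hydef, hPinj.eq_iff]
  have hwt : wt y = 4 := by
    have hsupp : Function.support y = Set.range P := by
      ext α
      constructor
      · intro hα
        obtain ⟨i, -, hi⟩ := Finset.exists_ne_zero_of_sum_ne_zero hα
        exact ⟨i, by by_contra hne; exact hi (if_neg (Ne.symm hne))⟩
      · rintro ⟨i, rfl⟩
        simpa [hyP] using hw i
    rw [wt, hsupp, ← Set.image_univ, Set.ncard_image_of_injective _ hPinj, Set.ncard_univ]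
    simp
  have hy : y ∈ dualToricCode F 2
      ({![0,0], ![1,0], ![0,1], ![2,0], ![1,1], ![0,2]} : Finset (Fin 2 → ℕ)) := by
    rw [mem_dualToricCode_two_iff]
    intro c₁ c₂ c₃ c₄ c₅ c₆
    simp only [hydef, Finset.sum_mul, ite_mul, zero_mul]
    rw [Finset.sum_comm]
    simp only [Finset.sum_ite_eq', Finset.mem_univ, if_true]
    rw [← hsum (c₁ + c₃ + c₆) (c₂ + c₅) c₄]
    refine Finset.sum_congr rfl fun i _ => ?_
    simp only [hP, Matrix.cons_val_zero, Matrix.cons_val_one, Units.val_one]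
    ring
  have hy0 : y ≠ 0 := fun h => hw 0 (by rw [← hyP, h]; rfl)
  refine le_antisymm (Nat.sInf_le ⟨y, hy, hy0, hwt⟩)
    (le_csInf ⟨4, y, hy, hy0, hwt⟩ ?_)
  rintro k ⟨z, hz, hz0, rfl⟩
  exact four_le_wt_of_orthogonal ((mem_dualToricCode_two_iff F z).mp hz) hz0
end

section
/- Let A ⊆ ℤ_{≥0}^m be either (i) the lattice-point set of an iterated pyramid over a Lawrence prism L(a₀,…,a_{s−1}) with s ≥ 2, namely A = {k·e_s : 0 ≤ k ≤ a₀} ∪ {e_i + k·e_s : 1 ≤ i ≤ s−1, 0 ≤ k ≤ a_i} ∪ {e_j : s+1 ≤ j ≤ m} for integers 0 < a₀ ≤ a₁ ≤ … ≤ a_{s−1} and m ≥ s, or (ii) the lattice-point set of an iterated pyramid over Δ₂ with m ≥ 3, namely A = {0, e₁, e₂, 2e₁, e₁+e₂, 2e₂} ∪ {e_j : 3 ≤ j ≤ m}. Then there exists q₀ such that for every prime power q ≥ q₀ the dual toric code C_A*(𝔽_q) has minimum distance exactly 3. -/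
/-- The `t`-th standard basis vector of `ℤ^m` (`1`-based index `t+1`). -/
def E (m t : ℕ) : Fin m → ℕ := fun j => if (j : ℕ) = t then 1 else 0

theorem sum_mul_monomial_eq_zero {F : Type} [Field F] [Fintype F] {m : ℕ}
    {A : Finset (Fin m → ℕ)} {y : (Fin m → Fˣ) → F} (hy : y ∈ dualToricCode F m A)
    {v : Fin m → ℕ} (hv : v ∈ A) :
    ∑ᶠ α : Fin m → Fˣ, y α * ∏ i, (α i : F) ^ v i = 0 := by
  classical
  rw [finsum_eq_sum_of_fintype]
  convert hy (fun α => ∏ i, (α i : F) ^ v i) ⟨Pi.single v 1, fun α => ?_⟩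
  simp [Pi.single_apply, hv]

theorem prod_pow_E {F : Type} [Field F] {m : ℕ} (α : Fin m → Fˣ) (j : Fin m) :
    ∏ i, (α i : F) ^ E m j i = α j := by
  simp [E, Fin.val_inj]

theorem three_le_wt_of_mem_dualToricCode {F : Type} [Field F] [Fintype F] {m : ℕ}
    {A : Finset (Fin m → ℕ)} (h0 : 0 ∈ A) (hE : ∀ j : Fin m, E m j ∈ A)
    {y : (Fin m → Fˣ) → F} (hy : y ∈ dualToricCode F m A) (hne : y ≠ 0) : 3 ≤ wt y := by
  classical
  have hsum : ∀ (s : Finset (Fin m → Fˣ)) (v : Fin m → ℕ), Function.support y = s → v ∈ A →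
      ∑ α ∈ s, y α * ∏ i, (α i : F) ^ v i = 0 := by
    intro s v hs hv
    rw [← sum_mul_monomial_eq_zero hy hv]
    refine (finsum_eq_sum_of_support_subset _ ?_).symm
    rw [← hs]
    exact fun α hα => left_ne_zero_of_mul hα
  by_contra! hlt
  unfold wt at hlt
  interval_cases hk : (Function.support y).ncard
  · rw [Set.ncard_eq_zero, Function.support_eq_empty_iff] at hk
    exact hne hk
  · obtain ⟨α, hα⟩ := Set.ncard_eq_one.mp hk
    have h1 := hsum {α} 0 (by simpa using hα) h0
    have hmem : α ∈ Function.support y := by simp [hα]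
    exact hmem (by simpa using h1)
  · obtain ⟨α, β, hαβ, hs⟩ := Set.ncard_eq_two.mp hk
    have hs' : Function.support y = (({α, β} : Finset (Fin m → Fˣ)) : Set _) := by simpa using hs
    have hmem : α ∈ Function.support y := by simp [hs]
    have h1 : y α + y β = 0 := by
      simpa [Finset.sum_pair hαβ] using hsum _ 0 hs' h0
    refine hαβ (funext fun j => Units.ext ?_)
    have h2 : y α * α j + y β * β j = 0 := by
      simpa only [Finset.sum_pair hαβ, prod_pow_E] using hsum _ _ hs' (hE j)
    have h3 : y α * ((α j : F) - β j) = 0 := by linear_combination h2 - (β j : F) * h1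
    exact sub_eq_zero.mp ((mul_eq_zero.mp h3).resolve_left hmem)

theorem exists_eq_add_mul_of_mem_toricCode {F : Type} [Field F] {m : ℕ}
    {A : Finset (Fin m → ℕ)} {p : Fin m} (hp : ∀ v ∈ A, v p ≤ 1)
    {w : (Fin m → Fˣ) → F} (hw : w ∈ toricCode F m A) :
    ∃ b c : F, ∀ u : Fˣ, w (Pi.mulSingle p u) = b + c * u := by
  obtain ⟨c, hc⟩ := hw
  refine ⟨∑ a ∈ A, if a p = 0 then c a else 0, ∑ a ∈ A, if a p = 0 then 0 else c a, fun u => ?_⟩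
  rw [hc, Finset.sum_mul, ← Finset.sum_add_distrib]
  refine Finset.sum_congr rfl fun a ha => ?_
  have hprod : ∏ i, ((Pi.mulSingle p u : Fin m → Fˣ) i : F) ^ a i = (u : F) ^ a p := by
    rw [Finset.prod_eq_single p (fun i _ hi => by simp [hi]) (by simp)]
    simp
  rw [hprod]
  have := hp a ha
  interval_cases h : a p <;> simp

theorem exists_mem_dualToricCode_wt_eq_three {F : Type} [Field F] [Fintype F] {m : ℕ}
    {A : Finset (Fin m → ℕ)} {p : Fin m} (hp : ∀ v ∈ A, v p ≤ 1) (hF : 4 ≤ Fintype.card F) :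
    ∃ y ∈ dualToricCode F m A, y ≠ 0 ∧ wt y = 3 := by
  classical
  have hcard : 2 < (Finset.univ : Finset Fˣ).card := by
    rw [Finset.card_univ, Fintype.card_units]
    omega
  obtain ⟨u₁, u₂, u₃, -, -, -, h12, h13, h23⟩ := Finset.two_lt_card_iff.mp hcard
  set P : Fˣ → Fin m → Fˣ := Pi.mulSingle (M := fun _ => Fˣ) p with hP
  have hinj : Function.Injective P := Pi.mulSingle_injective p
  let y : (Fin m → Fˣ) → F := Pi.single (P u₁) ((u₂ : F) - u₃) +
    Pi.single (P u₂) ((u₃ : F) - u₁) + Pi.single (P u₃) ((u₁ : F) - u₂)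
  have hsupp : Function.support y = {P u₁, P u₂, P u₃} := by
    ext α
    simp only [Function.mem_support, Set.mem_insert_iff, Set.mem_singleton_iff]
    have hz : ∀ {a b : Fˣ}, a ≠ b → (a : F) - b ≠ 0 :=
      fun hab h => hab (Units.ext (sub_eq_zero.mp h))
    constructor
    · intro hα
      by_contra! hn
      exact hα (by simp [y, hn])
    · rintro (rfl | rfl | rfl)
      · simpa [y, hinj.eq_iff, h12, h13] using hz h23
      · simpa [y, Pi.single_apply, hinj.eq_iff, h12.symm, h23] using hz h13.symm
      · simpa [y, Pi.single_apply, hinj.eq_iff, h13.symm, h23.symm] using hz h12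
  refine ⟨y, fun w hw => ?_, ?_, ?_⟩
  · obtain ⟨b, c, hbc⟩ := exists_eq_add_mul_of_mem_toricCode hp hw
    rw [← finsum_eq_sum_of_fintype, finsum_eq_sum_of_fintype]
    simp only [y, Pi.add_apply, add_mul, Finset.sum_add_distrib, Pi.single_apply, ite_mul,
      zero_mul, Finset.sum_ite_eq', Finset.mem_univ, if_true, hP, hbc]
    ring
  · rw [← Function.support_nonempty_iff, hsupp]
    exact Set.insert_nonempty _ _
  · rw [wt, hsupp, Set.ncard_eq_three]
    exact ⟨_, _, _, hinj.ne h12, hinj.ne h13, hinj.ne h23, rfl⟩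

theorem dmin_dualToricCode_eq_three {F : Type} [Field F] [Fintype F] {m : ℕ}
    {A : Finset (Fin m → ℕ)} (h0 : 0 ∈ A) (hE : ∀ j : Fin m, E m j ∈ A)
    {p : Fin m} (hp : ∀ v ∈ A, v p ≤ 1) (hF : 4 ≤ Fintype.card F) :
    dmin (dualToricCode F m A) = 3 := by
  have hmem := exists_mem_dualToricCode_wt_eq_three hp hF
  refine le_antisymm (Nat.sInf_le hmem) (le_csInf ⟨3, hmem⟩ ?_)
  rintro k ⟨y, hy, hne, rfl⟩
  exact three_le_wt_of_mem_dualToricCode h0 hE hy hne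

/-- If `A` is the lattice-point set of an iterated pyramid over a Lawrence
prism `L(a₀,…,a_{s−1})` with `s ≥ 2`, or of an iterated pyramid over `Δ₂` with `m ≥ 3`
(i.e. of a degree-one polytope other than `Δ₂` itself), then there is `q₀` such that for
every finite field with at least `q₀` elements the dual toric code has minimum distance
exactly `3`.  (Here the paper's `1`-based basis vector `e_i` is `E m (i-1)`.) -/
theorem stmt11 (m : ℕ) (A : Finset (Fin m → ℕ))
    (h : (∃ s : ℕ, 2 ≤ s ∧ s ≤ m ∧ ∃ a : ℕ → ℕ,
            0 < a 0 ∧ (∀ i j, i ≤ j → j < s → a i ≤ a j) ∧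
            ∀ v : Fin m → ℕ, v ∈ A ↔
              ((∃ k, k ≤ a 0 ∧ v = k • E m (s - 1)) ∨
               (∃ i, 1 ≤ i ∧ i ≤ s - 1 ∧ ∃ k, k ≤ a i ∧ v = E m (i - 1) + k • E m (s - 1)) ∨
               (∃ j, s + 1 ≤ j ∧ j ≤ m ∧ v = E m (j - 1))))
      ∨ (3 ≤ m ∧ ∀ v : Fin m → ℕ, v ∈ A ↔
            (v = 0 ∨ v = E m 0 ∨ v = E m 1 ∨ v = 2 • E m 0 ∨ v = E m 0 + E m 1 ∨
             v = 2 • E m 1 ∨ (∃ j, 3 ≤ j ∧ j ≤ m ∧ v = E m (j - 1))))) :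
    ∃ q₀ : ℕ, ∀ (F : Type) [Field F] [Fintype F], q₀ ≤ Fintype.card F →
      dmin (dualToricCode F m A) = 3 := by
  refine ⟨4, fun F _ _ hF => ?_⟩
  rcases h with ⟨s, hs, hsm, a, ha0, hmono, hA⟩ | ⟨hm, hA⟩
  · refine dmin_dualToricCode_eq_three (p := ⟨0, by omega⟩) ?_ (fun j => ?_) (fun v hv => ?_) hF
    · exact (hA 0).mpr (Or.inl ⟨0, by simp, by simp⟩)
    · have hj := j.isLt
      rcases lt_trichotomy ((j : ℕ) + 1) s with hjs | hjs | hjs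
      · exact (hA _).mpr (Or.inr (Or.inl ⟨j + 1, by omega, by omega, 0, by simp, by simp⟩))
      · exact (hA _).mpr (Or.inl ⟨1, ha0, by simp [← hjs]⟩)
      · exact (hA _).mpr (Or.inr (Or.inr ⟨j + 1, by omega, by omega, by simp⟩))
    · have hs0 : ¬ 0 = s - 1 := by omega
      rcases (hA v).mp hv with ⟨k, -, rfl⟩ | ⟨i, -, -, k, -, rfl⟩ | ⟨j, -, -, rfl⟩
      · simp [E, hs0]
      · simp only [E, hs0, Pi.add_apply, Pi.smul_apply, if_false]
        split_ifs <;> simp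
      · simp only [E]
        split_ifs <;> simp
  · refine dmin_dualToricCode_eq_three (p := ⟨2, by omega⟩) ?_ (fun j => ?_) (fun v hv => ?_) hF
    · exact (hA 0).mpr (Or.inl rfl)
    · obtain ⟨j, hj⟩ := j
      rw [hA]
      rcases j with _ | _ | j
      · simp
      · simp
      · iterate 6 right
        exact ⟨j + 3, by omega, by omega, by simp⟩
    · rcases (hA v).mp hv with rfl | rfl | rfl | rfl | rfl | rfl | ⟨j, -, -, rfl⟩
      iterate 6 simp [E]
      simp only [E]
      split_ifs <;> simp
end

section
/- Let m ≥ 2 and let A = {0, e₁, e₂, 2e₁, e₁+e₂, 2e₂} ∪ {e_j : 3 ≤ j ≤ m} ⊆ ℤ_{≥0}^m (the lattice points of the (m−2)-fold iterated pyramid over Δ₂ = Conv((0,0),(2,0),(0,2))). Then for every prime power q ≥ 4 the toric code C_A(𝔽_q) has length (q−1)^m, rank (dimension as an 𝔽_q-vector space) m + 4, and minimum distance (q−1)^m − 2(q−1)^{m−1}. -/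
open Classical in
/-- **Schwartz–Zippel on the torus**: a nonzero polynomial with exponents in `A`, all of total
degree at most `d`, has at most `d * (q - 1) ^ k` zeros on `(𝔽_qˣ)^(k + 1)`. -/
theorem card_torus_zeros_le {k d : ℕ} {F : Type} [Field F] [Fintype F]
    {A : Finset (Fin (k + 1) → ℕ)} (hd : ∀ a ∈ A, ∑ i, a i ≤ d)
    {c : (Fin (k + 1) → ℕ) → F} (hc : ∃ a ∈ A, c a ≠ 0) :
    (Finset.univ.filter fun α : Fin (k + 1) → Fˣ =>
      ∑ a ∈ A, c a * ∏ i, (α i : F) ^ a i = 0).card ≤ d * (Fintype.card F - 1) ^ k := by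
  set p : MvPolynomial (Fin (k + 1)) F :=
    ∑ a ∈ A, MvPolynomial.monomial (Finsupp.equivFunOnFinite.symm a) (c a) with hp
  have heval : ∀ x : Fin (k + 1) → F,
      MvPolynomial.eval x p = ∑ a ∈ A, c a * ∏ i, x i ^ a i := by
    intro x
    rw [hp, map_sum]
    refine Finset.sum_congr rfl fun a _ => ?_
    rw [MvPolynomial.eval_monomial, Finsupp.prod_fintype _ _ (by simp)]
    simp
  have hp0 : p ≠ 0 := by
    obtain ⟨a, ha, hca⟩ := hc
    intro h
    apply hca
    have := congrArg (MvPolynomial.coeff (Finsupp.equivFunOnFinite.symm a)) h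
    simpa [hp, MvPolynomial.coeff_sum, MvPolynomial.coeff_monomial, ha] using this
  have hdeg : p.totalDegree ≤ d := by
    refine MvPolynomial.totalDegree_finsetSum_le fun a ha => ?_
    refine (MvPolynomial.totalDegree_monomial_le _ _).trans ?_
    rw [Finsupp.sum_fintype _ _ (by simp)]
    simpa using hd a ha
  set S : Finset F := Finset.univ.image (Units.val : Fˣ → F) with hS
  have hScard : S.card = Fintype.card F - 1 := by
    rw [hS, Finset.card_image_of_injective _ Units.val_injective, Finset.card_univ,
      Fintype.card_units]
  have hSpos : 0 < S.card := Finset.card_pos.2 ⟨1, by simp [hS]⟩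
  have hSZ := MvPolynomial.schwartz_zippel_totalDegree hp0 S
  have hle : (Finset.univ.filter fun α : Fin (k + 1) → Fˣ =>
      ∑ a ∈ A, c a * ∏ i, (α i : F) ^ a i = 0).card ≤
      ((Fintype.piFinset fun _ : Fin (k + 1) => S).filter
        fun f => MvPolynomial.eval f p = 0).card := by
    refine Finset.card_le_card_of_injOn (fun α i => (α i : F)) ?_ ?_
    · intro α hα
      simp only [Finset.coe_filter, Finset.mem_univ, true_and, Set.mem_ofPred_eq] at hα
      simp [heval, hα, hS]
    · intro α _ β _ h
      funext i
      exact Units.ext (congrFun h i)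
  refine hle.trans ?_
  have hSq : (0 : ℚ≥0) < S.card := by exact_mod_cast hSpos
  rw [div_le_div_iff₀ (by positivity) hSq, pow_succ, ← mul_assoc] at hSZ
  have h := le_of_mul_le_mul_right hSZ hSq
  rw [← hScard]
  refine le_trans (by exact_mod_cast h) (Nat.mul_le_mul_right (S.card ^ k) hdeg)

/-- The weight of a word and its number of zeros add up to the length of the code. -/
theorem wt_add_card_zeros {m : ℕ} {F : Type} [Field F] [Fintype F] [DecidableEq F]
    (y : (Fin m → Fˣ) → F) :
    wt y + (Finset.univ.filter fun α => y α = 0).card = (Fintype.card F - 1) ^ m := by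
  have h : Function.support y = ↑(Finset.univ.filter fun α => y α ≠ 0) := by
    ext α
    simp
  rw [wt, h, Set.ncard_coe_finset, add_comm, Finset.card_filter_add_card_filter_not]
  simp [Fintype.card_units]

/-- The toric code is the span of its monomial words. -/
theorem toricCode_eq_span (F : Type) [Field F] (m : ℕ) (A : Finset (Fin m → ℕ)) :
    toricCode F m A = (Submodule.span F (Set.range fun (a : A) (α : Fin m → Fˣ) =>
      ∏ i, (α i : F) ^ a.1 i) : Set ((Fin m → Fˣ) → F)) := by
  classical
  rw [← Fintype.range_linearCombination]
  ext w
  constructor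
  · rintro ⟨c, hc⟩
    refine ⟨fun a => c a, ?_⟩
    funext α
    rw [hc, Fintype.linearCombination_apply, Finset.sum_apply, ← Finset.sum_coe_sort A]
    rfl
  · rintro ⟨c, rfl⟩
    refine ⟨fun a => if h : a ∈ A then c ⟨a, h⟩ else 0, fun α => ?_⟩
    rw [Fintype.linearCombination_apply, Finset.sum_apply, ← Finset.sum_coe_sort A]
    simp

/-- If all exponents in `A` have total degree at most `d < q - 1`, the monomial words are linearly
independent. -/
theorem linearIndependent_monomial_words {k d : ℕ} {F : Type} [Field F] [Fintype F]
    {A : Finset (Fin (k + 1) → ℕ)} (hd : ∀ a ∈ A, ∑ i, a i ≤ d)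
    (hdq : d < Fintype.card F - 1) :
    LinearIndependent F fun (a : A) (α : Fin (k + 1) → Fˣ) => ∏ i, (α i : F) ^ a.1 i := by
  classical
  rw [Fintype.linearIndependent_iff]
  intro g hg
  by_contra! hne
  obtain ⟨a, ha⟩ := hne
  let c : (Fin (k + 1) → ℕ) → F := fun a => if h : a ∈ A then g ⟨a, h⟩ else 0
  have hz : ∀ α : Fin (k + 1) → Fˣ, ∑ a ∈ A, c a * ∏ i, (α i : F) ^ a i = 0 := by
    intro α
    have := congrFun hg α
    rw [Finset.sum_apply] at this
    rw [← Finset.sum_coe_sort A]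
    simpa [c] using this
  have hle := card_torus_zeros_le hd (c := c) ⟨a, a.2, by simpa [c] using ha⟩
  rw [Finset.filter_true_of_mem fun α _ => hz α, Finset.card_univ, Fintype.card_fun,
    Fintype.card_units, Fintype.card_fin, pow_succ'] at hle
  have hpos : 0 < (Fintype.card F - 1) ^ k := pow_pos (by omega) _
  exact absurd (Nat.le_of_mul_le_mul_right hle hpos) (by omega)

/-- The word of `(x₀ - a) (x₀ - b)` with `a ≠ b` units vanishes on two hyperplanes of the torus. -/
theorem wt_mul_sub {k : ℕ} {F : Type} [Field F] [Fintype F] {a b : Fˣ} (hab : a ≠ b) :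
    wt (fun α : Fin (k + 1) → Fˣ => ((α 0 : F) - a) * ((α 0 : F) - b)) =
      (Fintype.card F - 1) ^ (k + 1) - 2 * (Fintype.card F - 1) ^ k := by
  classical
  have h : Function.support (fun α : Fin (k + 1) → Fˣ => ((α 0 : F) - a) * ((α 0 : F) - b)) =
      ↑(Fintype.piFinset (Fin.cons ({a, b}ᶜ) fun _ => Finset.univ :
        Fin (k + 1) → Finset Fˣ)) := by
    ext α
    simp [Fin.forall_fin_succ, sub_eq_zero, Units.val_inj]
  rw [wt, h, Set.ncard_coe_finset, Fintype.card_piFinset, Fin.prod_univ_succ]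
  simp only [Fin.cons_zero, Fin.cons_succ, Finset.card_compl, Finset.card_pair hab, Finset.card_univ,
    Fintype.card_units, Finset.prod_const, Fintype.card_fin, Nat.sub_mul, pow_succ']

/-- The lattice points of the iterated pyramid over `Δ₂`, counted. -/
theorem card_pyramid {m : ℕ} (hm : 2 ≤ m) {A : Finset (Fin m → ℕ)}
    (hA : ∀ v : Fin m → ℕ, v ∈ A ↔
        (v = 0 ∨ v = E m 0 ∨ v = E m 1 ∨ v = 2 • E m 0 ∨ v = E m 0 + E m 1 ∨
         v = 2 • E m 1 ∨ (∃ j, 3 ≤ j ∧ j ≤ m ∧ v = E m (j - 1)))) :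
    A.card = m + 4 := by
  classical
  let i₀ : Fin m := ⟨0, by omega⟩
  let i₁ : Fin m := ⟨1, by omega⟩
  have hEq : A = ({0, 2 • E m 0, E m 0 + E m 1, 2 • E m 1} : Finset (Fin m → ℕ)) ∪
      (Finset.range m).image (E m) := by
    ext v
    simp only [hA, Finset.mem_union, Finset.mem_insert, Finset.mem_singleton, Finset.mem_image,
      Finset.mem_range]
    constructor
    · rintro (h | h | h | h | h | h | ⟨j, h3, hj, h⟩)
      · simp [h]
      · exact Or.inr ⟨0, by omega, h.symm⟩
      · exact Or.inr ⟨1, by omega, h.symm⟩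
      · simp [h]
      · simp [h]
      · simp [h]
      · exact Or.inr ⟨j - 1, by omega, h.symm⟩
    · rintro ((h | h | h | h) | ⟨j, hj, rfl⟩)
      · simp [h]
      · simp [h]
      · simp [h]
      · simp [h]
      · match j, hj with
        | 0, _ => simp
        | 1, _ => simp
        | j + 2, hj =>
          iterate 6 right
          exact ⟨j + 3, by omega, by omega, rfl⟩
  have hne : ∀ {u v : Fin m → ℕ} (i : Fin m), u i ≠ v i → u ≠ v :=
    fun i h huv => h (congrFun huv i)
  have h4 : ({0, 2 • E m 0, E m 0 + E m 1, 2 • E m 1} : Finset (Fin m → ℕ)).card = 4 := by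
    rw [Finset.card_insert_of_notMem, Finset.card_insert_of_notMem, Finset.card_pair]
    · exact hne i₀ (by simp [E, i₀])
    · simp only [Finset.mem_insert, Finset.mem_singleton, not_or]
      exact ⟨hne i₀ (by simp [E, i₀]), hne i₀ (by simp [E, i₀])⟩
    · simp only [Finset.mem_insert, Finset.mem_singleton, not_or]
      exact ⟨hne i₀ (by simp [E, i₀]), hne i₀ (by simp [E, i₀]), hne i₁ (by simp [E, i₁])⟩
  have hdisj : Disjoint ({0, 2 • E m 0, E m 0 + E m 1, 2 • E m 1} : Finset (Fin m → ℕ))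
      ((Finset.range m).image (E m)) := by
    rw [Finset.disjoint_right]
    simp only [Finset.mem_image, Finset.mem_range, Finset.mem_insert, Finset.mem_singleton, not_or]
    rintro _ ⟨j, hj, rfl⟩
    refine ⟨hne ⟨j, hj⟩ (by simp [E]), hne i₀ ?_, fun h => ?_, hne i₁ ?_⟩
    · simp only [E, i₀, Pi.smul_apply, smul_eq_mul]
      split_ifs <;> omega
    · have h0 := congrFun h i₀
      have h1 := congrFun h i₁
      simp [E, i₀, i₁] at h0 h1
      omega
    · simp only [E, i₁, Pi.smul_apply, smul_eq_mul]
      split_ifs <;> omega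
  have hinj : Set.InjOn (E m) (Finset.range m : Set ℕ) := by
    intro j hj l _ h
    have hj' : j < m := by simpa using hj
    have := congrFun h ⟨j, hj'⟩
    by_contra hjl
    simp [E, hjl] at this
  rw [hEq, Finset.card_union_of_disjoint hdisj, h4, Finset.card_image_of_injOn hinj,
    Finset.card_range, add_comm]

/-- A standard basis vector has total degree at most one. -/
theorem sum_E_le_one (m t : ℕ) : ∑ i, E m t i ≤ 1 := by
  have : ∑ i, E m t i = (Finset.univ.filter fun i : Fin m => (i : ℕ) = t).card := by
    simp [E]
  rw [this, Finset.card_le_one]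
  intro a ha b hb
  simp only [Finset.mem_filter, Finset.mem_univ, true_and] at ha hb
  exact Fin.ext (ha.trans hb.symm)

/-- For `m ≥ 2` and `A` the lattice points of the `(m−2)`-fold iterated
pyramid over `Δ₂`, and every finite field with `q ≥ 4` elements, the toric code `C_A(𝔽_q)`
has length `(q−1)^m`, rank `m + 4` and minimum distance `(q−1)^m − 2(q−1)^{m−1}`. -/
theorem stmt12 (m : ℕ) (hm : 2 ≤ m) (A : Finset (Fin m → ℕ))
    (hA : ∀ v : Fin m → ℕ, v ∈ A ↔
        (v = 0 ∨ v = E m 0 ∨ v = E m 1 ∨ v = 2 • E m 0 ∨ v = E m 0 + E m 1 ∨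
         v = 2 • E m 1 ∨ (∃ j, 3 ≤ j ∧ j ≤ m ∧ v = E m (j - 1))))
    (F : Type) [Field F] [Fintype F] (hq : 4 ≤ Fintype.card F) :
    Nat.card (Fin m → Fˣ) = (Fintype.card F - 1) ^ m ∧
    Module.finrank F ↥(Submodule.span F (toricCode F m A)) = m + 4 ∧
    dmin (toricCode F m A)
      = (Fintype.card F - 1) ^ m - 2 * (Fintype.card F - 1) ^ (m - 1) := by
  classical
  obtain ⟨k, rfl⟩ : ∃ k, m = k + 1 := ⟨m - 1, by omega⟩
  have hd : ∀ a ∈ A, ∑ i, a i ≤ 2 := by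
    intro a ha
    have h0 := sum_E_le_one (k + 1) 0
    have h1 := sum_E_le_one (k + 1) 1
    rcases (hA a).1 ha with rfl | rfl | rfl | rfl | rfl | rfl | ⟨j, -, -, rfl⟩
    · simp
    · omega
    · omega
    · simp only [Pi.smul_apply, smul_eq_mul, ← Finset.mul_sum]; omega
    · simp only [Pi.add_apply, Finset.sum_add_distrib]; omega
    · simp only [Pi.smul_apply, smul_eq_mul, ← Finset.mul_sum]; omega
    · exact (sum_E_le_one (k + 1) (j - 1)).trans (by omega)
  have hspan := toricCode_eq_span F (k + 1) A
  refine ⟨?_, ?_, ?_⟩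
  · simp [Fintype.card_units]
  · rw [hspan, Submodule.span_eq,
      finrank_span_eq_card (linearIndependent_monomial_words hd (by omega)), Fintype.card_coe,
      card_pyramid hm hA]
  · obtain ⟨a, b, hab⟩ : ∃ a b : Fˣ, a ≠ b := by
      apply Fintype.exists_pair_of_one_lt_card
      rw [Fintype.card_units]
      omega
    have hpos : 0 < (Fintype.card F - 1) ^ k := pow_pos (by omega) _
    have hlt : 2 * (Fintype.card F - 1) ^ k < (Fintype.card F - 1) ^ (k + 1) := by
      rw [pow_succ']
      exact Nat.mul_lt_mul_of_pos_right (by omega) hpos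
    rw [Nat.add_sub_cancel]
    refine IsLeast.csInf_eq ⟨⟨_, ?_, ?_, wt_mul_sub hab⟩, ?_⟩
    · have hmem : ∀ v ∈ A, (fun α : Fin (k + 1) → Fˣ => ∏ i, (α i : F) ^ v i) ∈
          Submodule.span F (Set.range fun (a : A) (α : Fin (k + 1) → Fˣ) =>
            ∏ i, (α i : F) ^ a.1 i) :=
        fun v hv => Submodule.subset_span ⟨⟨v, hv⟩, rfl⟩
      have h0 := hmem 0 ((hA _).2 (by simp))
      have h1 := hmem (E (k + 1) 0) ((hA _).2 (by simp))
      have h2 := hmem (2 • E (k + 1) 0) ((hA _).2 (by simp))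
      rw [hspan, SetLike.mem_coe]
      convert add_mem (sub_mem h2 (Submodule.smul_mem _ (a + b : F) h1))
        (Submodule.smul_mem _ (a * b : F) h0) using 1
      funext α
      simp [E]
      ring
    · intro h
      have hw := wt_mul_sub (k := k) hab
      rw [h] at hw
      simp [wt] at hw
      omega
    · rintro _ ⟨y, ⟨c, hc⟩, hy, rfl⟩
      have hc0 : ∃ v ∈ A, c v ≠ 0 := by
        by_contra! h
        apply hy
        funext α
        rw [hc, Finset.sum_eq_zero fun v hv => by rw [h v hv, zero_mul]]
        rfl
      have hle := card_torus_zeros_le hd hc0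
      simp only [← hc] at hle
      have := wt_add_card_zeros y
      omega
end

section
/- Let s ≥ 2, m ≥ s, and let 0 < a₀ ≤ a₁ ≤ … ≤ a_{s−1} be integers with a_{s−2} < a_{s−1}. Let A = {k·e_s : 0 ≤ k ≤ a₀} ∪ {e_i + k·e_s : 1 ≤ i ≤ s−1, 0 ≤ k ≤ a_i} ∪ {e_j : s+1 ≤ j ≤ m} ⊆ ℤ_{≥0}^m (the lattice points of the (m−s)-fold iterated pyramid over the Lawrence prism L(a₀,…,a_{s−1})). Then for every prime power q with a_{s−1} ≤ q − 2, the toric code C_A(𝔽_q) has length (q−1)^m, rank m + Σ_{i=0}^{s−1} a_i, and minimum distance (q−1)^m − a_{s−1}·(q−1)^{m−1}. -/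
open Finset Polynomial

section PrismCode

variable {F : Type} [Field F] {m : ℕ}

/-- The exponent vector of the monomial `x_t * y ^ k` (of `y ^ k` if `t` is the index of `y`). -/
def prismExponent (y : Fin m) (p : Σ _ : Fin m, ℕ) : Fin m → ℕ :=
  (if p.1 = y then 0 else E m p.1) + p.2 • E m y

/-- The factor `x_t` of the monomials `x_t * y ^ k`, read as `1` if `t` is the index of `y`. -/
def prismFactor (y t : Fin m) (α : Fin m → Fˣ) : F :=
  if t = y then 1 else (α t : F)

/-- The word of the polynomial `∑ t, x_t * P_t(y)`. -/
def prismWord (y : Fin m) (P : Fin m → F[X]) (α : Fin m → Fˣ) : F :=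
  ∑ t, prismFactor y t α * (P t).eval (α y : F)

/-- The word of `∑ t, x_t * P_t(y)`, as a linear function of the coefficients `P_t`. -/
noncomputable def prismEval (F : Type) [Field F] (y : Fin m) (b : Fin m → ℕ) :
    ((t : Fin m) → degreeLT F (b t + 1)) →ₗ[F] ((Fin m → Fˣ) → F) where
  toFun P := prismWord y fun t => (P t : F[X])
  map_add' P Q := by
    ext α
    simp [prismWord, mul_add, sum_add_distrib]
  map_smul' c P := by
    ext α
    simp only [prismWord, Pi.smul_apply, Submodule.coe_smul, eval_smul, smul_eq_mul,
      RingHom.id_apply, mul_sum]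
    exact sum_congr rfl fun t _ => by ring

lemma prismExponent_apply_self (y t : Fin m) (k : ℕ) : prismExponent y ⟨t, k⟩ y = k := by
  by_cases h : t = y
  · simp [prismExponent, E, h]
  · have : ¬ ((y : ℕ) = t) := fun h' => h (Fin.ext h'.symm)
    simp [prismExponent, E, h, this]

lemma prismExponent_apply_of_ne {y i : Fin m} (hi : i ≠ y) (t : Fin m) (k : ℕ) :
    prismExponent y ⟨t, k⟩ i = if i = t then 1 else 0 := by
  have hiy : ¬ ((i : ℕ) = y) := fun h' => hi (Fin.ext h')
  by_cases h : t = y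
  · subst h
    simp [prismExponent, E, hi, hiy]
  · simp [prismExponent, E, h, hiy, Fin.ext_iff]

lemma prismExponent_injective (y : Fin m) : Function.Injective (prismExponent y) := by
  rintro ⟨t, k⟩ ⟨u, l⟩ h
  have hk : k = l := by
    simpa only [prismExponent_apply_self] using congrFun h y
  have htu : t = u := by
    by_cases ht : t = y
    · by_contra hne
      have hu : u ≠ y := fun h' => hne (ht.trans h'.symm)
      have := congrFun h u
      rw [prismExponent_apply_of_ne hu, prismExponent_apply_of_ne hu] at this
      simp [Ne.symm hne] at this
    · have := congrFun h t
      rw [prismExponent_apply_of_ne ht, prismExponent_apply_of_ne ht] at this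
      by_contra hne
      simp [hne] at this
  rw [hk, htu]

lemma prod_pow_prismExponent (y t : Fin m) (k : ℕ) (α : Fin m → Fˣ) :
    ∏ i, (α i : F) ^ prismExponent y ⟨t, k⟩ i = prismFactor y t α * (α y : F) ^ k := by
  rw [← mul_prod_erase univ _ (mem_univ y), prismExponent_apply_self, mul_comm]
  congr 1
  rw [prod_congr rfl fun i hi => by
    rw [prismExponent_apply_of_ne (ne_of_mem_erase hi)]]
  simp only [pow_ite, pow_one, pow_zero, prod_ite_eq', prismFactor, mem_erase, mem_univ, and_true]
  by_cases h : t = y <;> simp [h]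

lemma natDegree_le_of_mem_degreeLT_succ {p : F[X]} {n : ℕ} (hp : p ∈ degreeLT F (n + 1)) :
    p.natDegree ≤ n := by
  rw [natDegree_le_iff_degree_le, ← mem_degreeLE, ← degreeLT_succ_eq_degreeLE]
  exact hp

lemma toricCode_eq_range_prismEval (y : Fin m) (b : Fin m → ℕ) (A : Finset (Fin m → ℕ))
    (hA : A = (univ.sigma fun t => range (b t + 1)).image (prismExponent y)) :
    toricCode F m A = (LinearMap.range (prismEval F y b) : Set ((Fin m → Fˣ) → F)) := by
  have key (c : (Fin m → ℕ) → F) (α : Fin m → Fˣ) :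
      ∑ v ∈ A, c v * ∏ i, (α i : F) ^ v i =
        ∑ t, prismFactor y t α *
          ∑ k ∈ range (b t + 1), c (prismExponent y ⟨t, k⟩) * (α y : F) ^ k := by
    rw [hA, sum_image (prismExponent_injective y).injOn, sum_sigma]
    refine sum_congr rfl fun t _ => ?_
    rw [mul_sum]
    refine sum_congr rfl fun k _ => ?_
    rw [prod_pow_prismExponent]
    ring
  ext w
  simp only [toricCode, Set.mem_ofPred_eq, SetLike.mem_coe, LinearMap.mem_range]
  constructor
  · rintro ⟨c, hc⟩
    refine ⟨fun t => ⟨∑ k ∈ range (b t + 1), monomial k (c (prismExponent y ⟨t, k⟩)), ?_⟩, ?_⟩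
    · refine Submodule.sum_mem _ fun k hk => ?_
      rw [mem_degreeLT]
      exact (degree_monomial_le _ _).trans_lt (by exact_mod_cast mem_range.1 hk)
    · ext α
      rw [hc, key]
      simp [prismEval, prismWord, eval_finsetSum, eval_monomial]
  · rintro ⟨P, rfl⟩
    refine ⟨Function.extend (prismExponent y) (fun p => (P p.1 : F[X]).coeff p.2) 0, fun α => ?_⟩
    rw [key]
    change prismWord y (fun t => (P t : F[X])) α = _
    refine sum_congr rfl fun t _ => ?_
    have hdeg : (P t : F[X]).natDegree < b t + 1 :=
      Nat.lt_succ_of_le (natDegree_le_of_mem_degreeLT_succ (P t).2)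
    rw [eval_eq_sum_range' hdeg]
    simp only [(prismExponent_injective y).extend_apply]

lemma card_units_roots_le {p : F[X]} (hp : p ≠ 0) (S : Finset Fˣ)
    (hS : ∀ u ∈ S, p.eval (u : F) = 0) : #S ≤ p.natDegree := by
  rw [← card_map ⟨Units.val, Units.val_injective⟩]
  refine card_le_degree_of_subset_roots fun x hx => ?_
  obtain ⟨u, hu, rfl⟩ := mem_map.1 hx
  exact (mem_roots hp).2 (hS u hu)

lemma mul_pow_pred_lt {b N : ℕ} (hm : m ≠ 0) (hbN : b < N) : b * N ^ (m - 1) < N ^ m := by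
  obtain ⟨n, rfl⟩ := Nat.exists_eq_succ_of_ne_zero hm
  rw [pow_succ', Nat.succ_sub_one]
  exact Nat.mul_lt_mul_of_pos_right hbN (pow_pos (by omega) _)

variable [Fintype F] [DecidableEq F]

lemma card_filter_apply_mem (y : Fin m) (S : Finset Fˣ) :
    #{α : Fin m → Fˣ | α y ∈ S} = #S * Fintype.card Fˣ ^ (m - 1) := by
  have : ({α : Fin m → Fˣ | α y ∈ S} : Finset _) =
      Fintype.piFinset fun i => if i = y then S else univ := by
    ext α
    simp only [mem_filter, mem_univ, true_and, Fintype.mem_piFinset]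
    refine ⟨fun h i => ?_, fun h => by simpa using h y⟩
    by_cases hi : i = y
    · subst hi; simpa using h
    · simp [hi]
  rw [this, Fintype.card_piFinset, ← mul_prod_erase univ _ (mem_univ y), if_pos rfl]
  congr 1
  rw [prod_congr rfl fun i hi => by rw [if_neg (ne_of_mem_erase hi)]]
  simp

/-- Away from the common zeros of the coefficients, a fibre has few zeros. -/
lemma card_zeros_fiber_le (y : Fin m) (P : Fin m → F[X]) (u : Fˣ)
    (hu : ∃ t, (P t).eval (u : F) ≠ 0) :
    #{α : Fin m → Fˣ | prismWord y P α = 0 ∧ α y = u} ≤ Fintype.card Fˣ ^ (m - 2) := by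
  by_cases h : ∃ t, t ≠ y ∧ (P t).eval (u : F) ≠ 0
  · obtain ⟨t, hty, ht⟩ := h
    have hcard : Fintype.card (↥((univ.erase y).erase t) → Fˣ) =
        Fintype.card Fˣ ^ (m - 2) := by
      rw [Fintype.card_fun, Fintype.card_coe, card_erase_of_mem (by simp [hty]),
        card_erase_of_mem (mem_univ y), card_univ, Fintype.card_fin]
      rfl
    rw [← hcard, ← card_univ]
    refine card_le_card_of_injOn (fun α i => α i) (fun _ _ => by simp) ?_
    intro α hα β hβ hαβ
    simp only [coe_filter, mem_univ, true_and, Set.mem_ofPred_eq] at hα hβ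
    have hne : ∀ i, i ≠ t → α i = β i := by
      intro i hi
      by_cases hiy : i = y
      · rw [hiy, hα.2, hβ.2]
      · exact congrFun hαβ ⟨i, by simp [hi, hiy]⟩
    have hsum : ∑ i ∈ univ.erase t, prismFactor y i α * (P i).eval (α y : F) =
        ∑ i ∈ univ.erase t, prismFactor y i β * (P i).eval (β y : F) := by
      refine sum_congr rfl fun i hi => ?_
      rw [hα.2, hβ.2, prismFactor, prismFactor, hne i (ne_of_mem_erase hi)]
    have h0 := hα.1.trans hβ.1.symm
    rw [prismWord, prismWord, ← add_sum_erase univ _ (mem_univ t),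
      ← add_sum_erase univ _ (mem_univ t), hsum, add_left_inj, hα.2, hβ.2] at h0
    have := mul_right_cancel₀ ht h0
    simp only [prismFactor, if_neg hty] at this
    ext i
    by_cases hi : i = t
    · rw [hi, this]
    · rw [hne i hi]
  · push Not at h
    rw [card_eq_zero.2]
    · exact Nat.zero_le _
    · rw [filter_eq_empty_iff]
      rintro α - ⟨h0, rfl⟩
      obtain ⟨t, ht⟩ := hu
      have hty : t = y := by
        by_contra hne
        exact ht (h t hne)
      subst hty
      rw [prismWord, sum_eq_single t (fun i _ hi => by rw [h i hi, mul_zero]) (by simp)] at h0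
      simp [prismFactor] at h0
      exact ht h0

/-- The number of zeros of the word of `∑ t, x_t * P_t(y)`. -/
lemma card_zeros_prismWord_le {y t₀ : Fin m} (hty : t₀ ≠ y) (b : Fin m → ℕ)
    (hb : ∀ t, t ≠ t₀ → b t < b t₀) (P : Fin m → F[X]) (hP : ∃ t, P t ≠ 0)
    (hdeg : ∀ t, (P t).natDegree ≤ b t) :
    #{α : Fin m → Fˣ | prismWord y P α = 0} ≤ b t₀ * Fintype.card Fˣ ^ (m - 1) := by
  set N := Fintype.card Fˣ with hN
  have hm : 2 ≤ m := by
    have := t₀.2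
    have := y.2
    have : (t₀ : ℕ) ≠ y := fun h => hty (Fin.ext h)
    omega
  have hble (t : Fin m) : b t ≤ b t₀ := by
    by_cases h : t = t₀
    · rw [h]
    · exact (hb t h).le
  set S : Finset Fˣ := {u | ∀ t, (P t).eval (u : F) = 0} with hS
  have hSle (t : Fin m) (ht : P t ≠ 0) : #S ≤ b t :=
    (card_units_roots_le ht S fun u hu => (mem_filter.1 hu).2 t).trans (hdeg t)
  obtain ⟨t₁, ht₁⟩ := hP
  by_cases hlt : #S < b t₀
  · have hfib : #{α : Fin m → Fˣ | prismWord y P α = 0} ≤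
        ∑ u : Fˣ, if u ∈ S then N ^ (m - 1) else N ^ (m - 2) := by
      rw [card_eq_sum_card_fiberwise (f := fun α => α y) (t := univ) (fun _ _ => by simp)]
      refine sum_le_sum fun u _ => ?_
      rw [filter_filter]
      split_ifs with hu
      · calc _ ≤ #{α : Fin m → Fˣ | α y ∈ ({u} : Finset Fˣ)} :=
              card_le_card fun α => by simp +contextual
          _ = N ^ (m - 1) := by rw [card_filter_apply_mem, card_singleton, one_mul]
      · refine card_zeros_fiber_le y P u ?_
        simpa [hS] using hu
    have hpow : N ^ (m - 1) = N * N ^ (m - 2) := by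
      rw [← pow_succ']
      congr 1
      omega
    calc _ ≤ _ := hfib
      _ ≤ ∑ u : Fˣ, ((if u ∈ S then N ^ (m - 1) else 0) + N ^ (m - 2)) :=
          sum_le_sum fun u _ => by split_ifs <;> simp
      _ = (#S + 1) * N ^ (m - 1) := by
          rw [sum_add_distrib, sum_ite_mem, univ_inter, sum_const, sum_const, card_univ, ← hN,
            hpow, smul_eq_mul, smul_eq_mul]
          ring
      _ ≤ _ := Nat.mul_le_mul_right _ hlt
  · have hzero (t : Fin m) (ht : t ≠ t₀) : P t = 0 := by
      by_contra h
      exact hlt ((hSle t h).trans_lt (hb t ht))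
    calc _ ≤ #{α : Fin m → Fˣ | α y ∈ S} := by
            refine card_le_card fun α hα => ?_
            simp only [mem_filter, mem_univ, true_and, hS] at hα ⊢
            intro t
            by_cases ht : t = t₀
            · rw [prismWord, sum_eq_single t₀
                (fun i _ hi => by rw [hzero i hi, eval_zero, mul_zero]) (by simp)] at hα
              simpa [prismFactor, hty, ht] using hα
            · rw [hzero t ht, eval_zero]
      _ = #S * N ^ (m - 1) := card_filter_apply_mem y S
      _ ≤ _ := Nat.mul_le_mul_right _ ((hSle t₁ ht₁).trans (hble t₁))

lemma wt_add_card_zeros_s13 (w : (Fin m → Fˣ) → F) :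
    wt w + #{α | w α = 0} = Fintype.card Fˣ ^ m := by
  have : Function.support w = (({α | ¬ w α = 0} : Finset (Fin m → Fˣ)) : Set (Fin m → Fˣ)) := by
    ext α
    simp
  rw [wt, this, Set.ncard_coe_finset, add_comm, card_filter_add_card_filter_not, card_univ,
    Fintype.card_fun, Fintype.card_fin]

lemma le_wt_prismEval {y t₀ : Fin m} (hty : t₀ ≠ y) (b : Fin m → ℕ)
    (hb : ∀ t, t ≠ t₀ → b t < b t₀) (P : (t : Fin m) → degreeLT F (b t + 1)) (hP : P ≠ 0) :
    Fintype.card Fˣ ^ m - b t₀ * Fintype.card Fˣ ^ (m - 1) ≤ wt (prismEval F y b P) := by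
  have h := card_zeros_prismWord_le hty b hb (fun t => (P t : F[X]))
    (by
      by_contra! h
      exact hP (funext fun t => Subtype.ext (h t)))
    (fun t => natDegree_le_of_mem_degreeLT_succ (P t).2)
  have := wt_add_card_zeros_s13 (prismEval F y b P)
  change #{α : Fin m → Fˣ | prismEval F y b P α = 0} ≤ _ at h
  omega

lemma prismEval_injective {y t₀ : Fin m} (hty : t₀ ≠ y) (b : Fin m → ℕ)
    (hb : ∀ t, t ≠ t₀ → b t < b t₀) (hbN : b t₀ < Fintype.card Fˣ) :
    Function.Injective (prismEval F y b) := by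
  rw [injective_iff_map_eq_zero]
  intro P h0
  by_contra hP
  have h := le_wt_prismEval hty b hb P hP
  have hpos := mul_pow_pred_lt (m := m) (by have := y.2; omega) hbN
  rw [h0] at h
  simp only [wt, Function.support_zero, Set.ncard_empty] at h
  omega

lemma finrank_range_prismEval {y t₀ : Fin m} (hty : t₀ ≠ y) (b : Fin m → ℕ)
    (hb : ∀ t, t ≠ t₀ → b t < b t₀) (hbN : b t₀ < Fintype.card Fˣ) :
    Module.finrank F (LinearMap.range (prismEval F y b)) = ∑ t, (b t + 1) := by
  have (t : Fin m) : Module.Finite F (degreeLT F (b t + 1)) :=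
    Module.Finite.equiv (degreeLTEquiv F (b t + 1)).symm
  have (t : Fin m) : Module.Free F (degreeLT F (b t + 1)) :=
    Module.Free.of_equiv (degreeLTEquiv F (b t + 1)).symm
  rw [LinearMap.finrank_range_of_inj (prismEval_injective hty b hb hbN),
    Module.finrank_pi_fintype]
  refine sum_congr rfl fun t _ => ?_
  rw [(degreeLTEquiv F (b t + 1)).finrank_eq, Module.finrank_fin_fun]

lemma dmin_range_prismEval {y t₀ : Fin m} (hty : t₀ ≠ y) (b : Fin m → ℕ)
    (hb : ∀ t, t ≠ t₀ → b t < b t₀) (hbN : b t₀ < Fintype.card Fˣ) :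
    dmin (LinearMap.range (prismEval F y b) : Set ((Fin m → Fˣ) → F)) =
      Fintype.card Fˣ ^ m - b t₀ * Fintype.card Fˣ ^ (m - 1) := by
  obtain ⟨S, -, hS⟩ := exists_subset_card_eq (s := (univ : Finset Fˣ)) (n := b t₀)
    (by rw [card_univ]; exact hbN.le)
  set p : F[X] := ∏ u ∈ S, (X - C (u : F)) with hp
  have hmonic : p.Monic := monic_prod_of_monic _ _ fun u _ => monic_X_sub_C _
  have hpdeg : p ∈ degreeLT F (b t₀ + 1) := by
    rw [mem_degreeLT, degree_eq_natDegree hmonic.ne_zero, hp,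
      natDegree_prod_of_monic _ _ fun u _ => monic_X_sub_C _]
    simp [hS]
    exact_mod_cast Nat.lt_succ_self _
  set P : (t : Fin m) → degreeLT F (b t + 1) := Pi.single t₀ ⟨p, hpdeg⟩ with hPdef
  have hP0 : P ≠ 0 := by
    rw [hPdef, Ne, Pi.single_eq_zero_iff, Subtype.ext_iff]
    exact hmonic.ne_zero
  have hinj := prismEval_injective (F := F) hty b hb hbN
  have hmem : prismEval F y b P ∈ (LinearMap.range (prismEval F y b) :
      Set ((Fin m → Fˣ) → F)) := ⟨P, rfl⟩
  have hne : prismEval F y b P ≠ 0 := fun h => hP0 (hinj (h.trans (map_zero _).symm))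
  have hset : wt (prismEval F y b P) ∈ {k | ∃ w ∈ (LinearMap.range (prismEval F y b) :
      Set ((Fin m → Fˣ) → F)), w ≠ 0 ∧ wt w = k} := ⟨_, hmem, hne, rfl⟩
  apply le_antisymm
  · refine (Nat.sInf_le hset).trans ?_
    have hwt := wt_add_card_zeros_s13 (prismEval F y b P)
    have hz : b t₀ * Fintype.card Fˣ ^ (m - 1) ≤
        #{α : Fin m → Fˣ | prismEval F y b P α = 0} := by
      rw [← hS, ← card_filter_apply_mem y S]
      refine card_le_card fun α hα => ?_
      simp only [mem_filter, mem_univ, true_and] at hα ⊢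
      change prismWord y (fun t => (P t : F[X])) α = 0
      refine sum_eq_zero fun t _ => ?_
      by_cases ht : t = t₀
      · subst ht
        have : p.eval (α y : F) = 0 := by
          rw [hp, eval_prod]
          exact prod_eq_zero hα (by simp)
        simp [hPdef, this]
      · simp [hPdef, ht]
    omega
  · refine le_csInf ⟨_, hset⟩ ?_
    rintro _ ⟨_, ⟨Q, rfl⟩, hQ, rfl⟩
    exact le_wt_prismEval hty b hb Q fun h => hQ (by rw [h, map_zero])

end PrismCode

/-- The degree bound in `y` of the monomials `x_t * y ^ k` of the iterated pyramid over a
Lawrence prism, with `t` counted from `0` and `y` at position `s - 1`. -/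
def prismBound (s : ℕ) (a : ℕ → ℕ) (t : ℕ) : ℕ :=
  if t < s - 1 then a (t + 1) else if t = s - 1 then a 0 else 0

lemma sum_prismBound_add_one {s m : ℕ} (hs : 1 ≤ s) (hm : s ≤ m) (a : ℕ → ℕ) :
    ∑ t : Fin m, (prismBound s a t + 1) = m + ∑ i ∈ range s, a i := by
  rw [sum_add_distrib, sum_const, card_univ, Fintype.card_fin, smul_eq_mul, mul_one, add_comm,
    Fin.sum_univ_eq_sum_range (prismBound s a) m]
  congr 1
  rw [← sum_subset (range_subset_range.2 hm) fun t _ ht => by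
    rw [mem_range] at ht
    simp only [prismBound]
    rw [if_neg (by omega), if_neg (by omega)]]
  obtain ⟨n, rfl⟩ := Nat.exists_eq_add_of_le' hs
  rw [sum_range_succ, sum_range_succ' a]
  congr 1
  · refine sum_congr rfl fun t ht => ?_
    rw [mem_range] at ht
    simp [prismBound, ht]
  · simp [prismBound]

/-- For `A` the lattice points of the `(m−s)`-fold iterated pyramid over the
Lawrence prism `L(a₀,…,a_{s−1})` with `a_{s−2} < a_{s−1}` and `a_{s−1} ≤ q − 2`, the toric
code has length `(q−1)^m`, rank `m + ∑ aᵢ`, and minimum distance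
`(q−1)^m − a_{s−1}(q−1)^{m−1}`. -/
theorem stmt13 (s m : ℕ) (hs : 2 ≤ s) (hm : s ≤ m) (a : ℕ → ℕ)
    (ha0 : 0 < a 0) (hmono : ∀ i j, i ≤ j → j < s → a i ≤ a j)
    (hlt : a (s - 2) < a (s - 1))
    (A : Finset (Fin m → ℕ))
    (hA : ∀ v : Fin m → ℕ, v ∈ A ↔
        ((∃ k, k ≤ a 0 ∧ v = k • E m (s - 1)) ∨
         (∃ i, 1 ≤ i ∧ i ≤ s - 1 ∧ ∃ k, k ≤ a i ∧ v = E m (i - 1) + k • E m (s - 1)) ∨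
         (∃ j, s + 1 ≤ j ∧ j ≤ m ∧ v = E m (j - 1))))
    (F : Type) [Field F] [Fintype F] (hq : a (s - 1) ≤ Fintype.card F - 2) :
    Nat.card (Fin m → Fˣ) = (Fintype.card F - 1) ^ m ∧
    Module.finrank F ↥(Submodule.span F (toricCode F m A))
      = m + ∑ i ∈ Finset.range s, a i ∧
    dmin (toricCode F m A)
      = (Fintype.card F - 1) ^ m - a (s - 1) * (Fintype.card F - 1) ^ (m - 1) := by
  classical
  set y : Fin m := ⟨s - 1, by omega⟩ with hy
  set t₀ : Fin m := ⟨s - 2, by omega⟩ with ht₀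
  set b : Fin m → ℕ := fun t => prismBound s a t with hbdef
  have hty : t₀ ≠ y := fun h => by
    have := congrArg Fin.val h
    simp only [hy, ht₀] at this
    omega
  have hbt₀ : b t₀ = a (s - 1) := by
    simp only [hbdef, ht₀, prismBound]
    rw [if_pos (by omega)]
    congr 1
    omega
  have hb : ∀ t, t ≠ t₀ → b t < b t₀ := by
    intro t ht
    have ht' : (t : ℕ) ≠ s - 2 := fun h => ht (Fin.ext h)
    rw [hbt₀]
    simp only [hbdef, prismBound]
    split_ifs with h1 h2
    · exact (hmono _ _ (by omega) (by omega)).trans_lt hlt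
    · exact (hmono _ _ (by omega) (by omega)).trans_lt hlt
    · omega
  have hcard : Fintype.card Fˣ = Fintype.card F - 1 := Fintype.card_units F
  have hbN : b t₀ < Fintype.card Fˣ := by
    rw [hcard, hbt₀]
    omega
  have hAimage : A = (univ.sigma fun t => range (b t + 1)).image (prismExponent y) := by
    ext v
    simp only [hA, mem_image, mem_sigma, mem_univ, true_and, mem_range, Sigma.exists]
    constructor
    · rintro (⟨k, hk, rfl⟩ | ⟨i, hi, his, k, hk, rfl⟩ | ⟨j, hj, hjm, rfl⟩)
      · refine ⟨y, k, ?_, ?_⟩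
        · simp only [hbdef, prismBound, hy]
          rw [if_neg (by omega), if_true]
          omega
        · simp [prismExponent, hy]
      · refine ⟨⟨i - 1, by omega⟩, k, ?_, ?_⟩
        · simp only [hbdef, prismBound]
          rw [if_pos (by omega), Nat.sub_add_cancel hi]
          omega
        · simp only [prismExponent, hy, Fin.mk.injEq]
          rw [if_neg (by omega)]
      · refine ⟨⟨j - 1, by omega⟩, 0, Nat.succ_pos _, ?_⟩
        simp only [prismExponent, hy, Fin.mk.injEq, zero_smul, add_zero]
        rw [if_neg (by omega)]
    · rintro ⟨t, k, hk, rfl⟩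
      simp only [hbdef, prismBound] at hk
      split_ifs at hk with h1 h2
      · refine Or.inr (Or.inl ⟨t + 1, by omega, by omega, k, by omega, ?_⟩)
        simp only [prismExponent, hy, Fin.ext_iff]
        rw [if_neg (by omega), Nat.add_sub_cancel]
      · refine Or.inl ⟨k, by omega, ?_⟩
        simp only [prismExponent, hy, Fin.ext_iff]
        rw [if_pos h2, zero_add]
      · have := t.2
        refine Or.inr (Or.inr ⟨t + 1, by omega, by omega, ?_⟩)
        have hk0 : k = 0 := by omega
        simp only [prismExponent, hy, Fin.ext_iff, hk0, zero_smul, add_zero]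
        rw [if_neg h2, Nat.add_sub_cancel]
  refine ⟨?_, ?_, ?_⟩
  · rw [Nat.card_eq_fintype_card, Fintype.card_fun, Fintype.card_fin, hcard]
  · rw [toricCode_eq_range_prismEval y b A hAimage, Submodule.span_eq,
      finrank_range_prismEval hty b hb hbN]
    exact sum_prismBound_add_one (by omega) hm a
  · rw [toricCode_eq_range_prismEval y b A hAimage, dmin_range_prismEval hty b hb hbN, hbt₀, hcard]
end

section
/- Let q be a prime power, 1 ≤ f ≤ q − 2, and let A ⊆ ℤ_{≥0}^m be a finite set satisfying {0, e_m, 2e_m, …, f·e_m} ⊆ A ⊆ {x ∈ ℤ_{≥0}^m : x₁ + ⋯ + x_m ≤ f} (i.e. A contains the lattice points of the segment [0,f]·e_m and is contained in the lattice points of the f-th dilate of the standard simplex). Then the toric code C_A(𝔽_q) has minimum distance exactly (q−1)^m − f·(q−1)^{m−1}. -/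
open Finset in
/-- Words of the code that are supported in total degree at most `f` have at most
`f * |Fˣ| ^ n` zeros on the torus of dimension `n + 1` (Schwartz-Zippel). -/
lemma card_zeros_le_of_mem_toricCode {F : Type} [Field F] [Fintype F] {n f : ℕ}
    {A : Finset (Fin (n + 1) → ℕ)} (hA : ∀ v ∈ A, ∑ i, v i ≤ f)
    {y : (Fin (n + 1) → Fˣ) → F} (hy : y ∈ toricCode F (n + 1) A) (hy0 : y ≠ 0) :
    {α | y α = 0}.ncard ≤ f * (Fintype.card F - 1) ^ n := by
  classical
  obtain ⟨c, hc⟩ := hy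
  set p : MvPolynomial (Fin (n + 1)) F :=
    ∑ a ∈ A, MvPolynomial.monomial (Finsupp.equivFunOnFinite.symm a) (c a) with hp
  have heval : ∀ α : Fin (n + 1) → Fˣ, MvPolynomial.eval (fun i => (α i : F)) p = y α := by
    intro α
    rw [hc, hp, map_sum]
    refine sum_congr rfl fun a _ => ?_
    rw [MvPolynomial.eval_monomial, Finsupp.prod_fintype _ _ (by simp)]
    simp
  have hp0 : p ≠ 0 := by
    intro h
    refine hy0 (funext fun α => ?_)
    rw [← heval, h]
    simp
  have hdeg : p.totalDegree ≤ f := by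
    refine MvPolynomial.totalDegree_finsetSum_le fun a ha => ?_
    refine (MvPolynomial.totalDegree_monomial_le _ _).trans ?_
    rw [Finsupp.sum_fintype _ _ (by simp)]
    simpa using hA a ha
  set S : Finset F := univ.image (Units.val : Fˣ → F) with hS
  have hScard : #S = Fintype.card F - 1 := by
    rw [hS, card_image_of_injective _ Units.val_injective, card_univ, Fintype.card_units]
  have hq : 0 < Fintype.card F - 1 := by
    have := Fintype.one_lt_card (α := F)
    omega
  have hsz := MvPolynomial.schwartz_zippel_totalDegree hp0 S
  rw [hScard, div_le_div_iff₀ (by positivity) (by positivity), pow_succ, ← mul_assoc] at hsz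
  have hsz' := le_of_mul_le_mul_right hsz (by positivity)
  have hle : {α | y α = 0}.ncard ≤
      #{x ∈ Fintype.piFinset fun _ => S | MvPolynomial.eval x p = 0} := by
    rw [← Set.ncard_coe_finset]
    refine Set.ncard_le_ncard_of_injOn (fun α i => (α i : F)) ?_ ?_ (Finset.finite_toSet _)
    · intro α hα
      simpa [heval, hS] using hα
    · intro α _ β _ h
      funext i
      exact Units.ext (congrFun h i)
  refine hle.trans (le_trans (by exact_mod_cast hsz') (Nat.mul_le_mul_right _ hdeg))

/-- The weight of a word is the length minus the number of its zeros. -/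
lemma wt_eq_sub_card_zeros {F : Type} [Field F] [Fintype F] {m : ℕ} (y : (Fin m → Fˣ) → F) :
    wt y = (Fintype.card F - 1) ^ m - {α | y α = 0}.ncard := by
  classical
  have h : Function.support y = {α | y α = 0}ᶜ := by
    ext α
    simp
  rw [wt, h, Set.ncard_compl, Nat.card_eq_fintype_card]
  simp [Fintype.card_units]

/-- The number of points of the torus whose last coordinate lies in a prescribed set. -/
lemma ncard_last_mem {F : Type} [Field F] [Fintype F] (n : ℕ) (T : Finset Fˣ) :
    {α : Fin (n + 1) → Fˣ | α (Fin.last n) ∈ T}.ncard = T.card * (Fintype.card F - 1) ^ n := by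
  classical
  have h : {α : Fin (n + 1) → Fˣ | α (Fin.last n) ∈ T} =
      (Fintype.piFinset fun i => if i = Fin.last n then T else Finset.univ :
        Finset (Fin (n + 1) → Fˣ)) := by
    ext α
    simp only [Set.mem_ofPred_eq, Finset.mem_coe, Fintype.mem_piFinset]
    refine ⟨fun hα i => ?_, fun hα => by simpa using hα (Fin.last n)⟩
    split_ifs with hi
    · exact hi ▸ hα
    · exact Finset.mem_univ _
  rw [h, Set.ncard_coe_finset, Fintype.card_piFinset, Fin.prod_univ_castSucc]
  simp [Fin.castSucc_ne_last, Fintype.card_units, mul_comm]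

/-- Evaluations of univariate polynomials of degree at most `f` in the last coordinate belong to
the toric code as soon as the exponent set contains the segment `[0, f] · e_m`. -/
lemma eval_last_mem_toricCode {F : Type} [Field F] {n f : ℕ}
    {A : Finset (Fin (n + 1) → ℕ)} (hseg : ∀ k ≤ f, (k • E (n + 1) n) ∈ A)
    {P : Polynomial F} (hP : P.natDegree ≤ f) :
    (fun α : Fin (n + 1) → Fˣ => P.eval (α (Fin.last n) : F)) ∈ toricCode F (n + 1) A := by
  classical
  refine ⟨fun a => ∑ k ∈ Finset.range (f + 1), if a = k • E (n + 1) n then P.coeff k else 0,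
    fun α => ?_⟩
  simp only [Finset.sum_mul]
  rw [Finset.sum_comm, Polynomial.eval_eq_sum_range' (Nat.lt_succ_of_le hP)]
  refine Finset.sum_congr rfl fun k hk => ?_
  have hkA := hseg k (Nat.lt_succ_iff.mp (Finset.mem_range.mp hk))
  simp only [ite_mul, zero_mul]
  rw [Finset.sum_ite_eq' A, if_pos hkA, Fin.prod_univ_castSucc]
  simp [E, (Fin.is_lt _).ne]

/-- If `1 ≤ f ≤ q − 2` and `A` contains the lattice points of the segment
`[0,f]·e_m` and is contained in the lattice points of `f·Δ` (the `f`-th dilate of the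
standard simplex), then the toric code `C_A(𝔽_q)` has minimum distance exactly
`(q−1)^m − f(q−1)^{m−1}`. -/
theorem stmt15 (F : Type) [Field F] [Fintype F] (m f : ℕ) (hm : 1 ≤ m)
    (hf1 : 1 ≤ f) (hf2 : f ≤ Fintype.card F - 2)
    (A : Finset (Fin m → ℕ))
    (hseg : ∀ k ≤ f, (k • E m (m - 1)) ∈ A)
    (hsimplex : ∀ v ∈ A, ∑ i, v i ≤ f) :
    dmin (toricCode F m A)
      = (Fintype.card F - 1) ^ m - f * (Fintype.card F - 1) ^ (m - 1) := by
  classical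
  obtain ⟨n, rfl⟩ : ∃ n, m = n + 1 := ⟨m - 1, by omega⟩
  simp only [Nat.add_sub_cancel] at hseg ⊢
  have hcard : Fintype.card Fˣ = Fintype.card F - 1 := Fintype.card_units F
  obtain ⟨T, -, hT⟩ := Finset.exists_subset_card_eq (s := (Finset.univ : Finset Fˣ)) (n := f)
    (by rw [Finset.card_univ]; omega)
  set P : Polynomial F := ∏ b ∈ T, (Polynomial.X - Polynomial.C (b : F)) with hP
  have hdeg : P.natDegree ≤ f := by
    rw [hP, Polynomial.natDegree_finsetProd_X_sub_C_eq_card, hT]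
  have hzero : {α : Fin (n + 1) → Fˣ | P.eval (α (Fin.last n) : F) = 0} =
      {α | α (Fin.last n) ∈ T} := by
    ext α
    simp [hP, Polynomial.eval_prod, Finset.prod_eq_zero_iff, sub_eq_zero, Units.val_inj]
  have hwt : wt (fun α : Fin (n + 1) → Fˣ => P.eval (α (Fin.last n) : F)) =
      (Fintype.card F - 1) ^ (n + 1) - f * (Fintype.card F - 1) ^ n := by
    rw [wt_eq_sub_card_zeros, hzero, ncard_last_mem, hT]
  have hne : (fun α : Fin (n + 1) → Fˣ => P.eval (α (Fin.last n) : F)) ≠ 0 := by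
    obtain ⟨b, hb⟩ : ∃ b, b ∉ T := by
      by_contra! h
      have hle := Finset.card_le_card (fun b _ => h b : (Finset.univ : Finset Fˣ) ⊆ T)
      rw [Finset.card_univ] at hle
      omega
    intro h
    have hmem : (fun _ => b) ∈ {α : Fin (n + 1) → Fˣ | P.eval (α (Fin.last n) : F) = 0} :=
      congrFun h fun _ => b
    rw [hzero] at hmem
    exact hb hmem
  refine IsLeast.csInf_eq ⟨⟨_, eval_last_mem_toricCode hseg hdeg, hne, hwt⟩, ?_⟩
  rintro _ ⟨y, hy, hy0, rfl⟩
  rw [wt_eq_sub_card_zeros]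
  exact Nat.sub_le_sub_left (card_zeros_le_of_mem_toricCode hsimplex hy hy0) _
end

section
/- Let q be a prime power and let A ⊆ ℤ_{≥0}^m be a finite set such that the differences {a − a′ : a, a′ ∈ A} generate ℤ^m as a group. Then for any two distinct points α, β ∈ (𝔽_q^*)^m, the evaluation vectors (α^a)_{a∈A} and (β^a)_{a∈A} in 𝔽_q^A are nonzero and neither is a scalar multiple of the other; in particular any two distinct points of the torus give linearly independent evaluation vectors. -/
/-- Points of a torus are separated by ratios of monomials whose exponent differences generate the
character lattice. -/
theorem eq_of_monomial_ratios_eq {G ι : Type*} [CommGroup G] [Fintype ι] (A : Set (ι → ℕ))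
    (hgen : AddSubgroup.closure
        {v : ι → ℤ | ∃ a ∈ A, ∃ b ∈ A, v = fun i => (a i : ℤ) - (b i : ℤ)} = ⊤)
    (α β : ι → G)
    (h : ∀ a ∈ A, ∀ b ∈ A,
      (∏ i, α i ^ a i) * ∏ i, β i ^ b i = (∏ i, α i ^ b i) * ∏ i, β i ^ a i) :
    α = β := by
  classical
  have key : ∀ v : ι → ℤ, ∏ i, (α i / β i) ^ v i = 1 := by
    intro v
    have hv : v ∈ AddSubgroup.closure
        {v : ι → ℤ | ∃ a ∈ A, ∃ b ∈ A, v = fun i => (a i : ℤ) - (b i : ℤ)} := by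
      rw [hgen]; trivial
    induction hv using AddSubgroup.closure_induction with
    | mem v hv =>
      obtain ⟨a, ha, b, hb, rfl⟩ := hv
      simp only [zpow_sub, zpow_natCast, div_pow, Finset.prod_mul_distrib,
        Finset.prod_inv_distrib, Finset.prod_div_distrib]
      rw [← div_eq_mul_inv, div_div_div_eq, h a ha b hb, mul_comm, div_self']
    | zero => simp
    | add v w _ _ hv hw => simp [zpow_add, Finset.prod_mul_distrib, hv, hw]
    | neg v _ hv => simp [zpow_neg, Finset.prod_inv_distrib, hv]
  funext j
  have hj := key (Pi.single j 1)
  rw [Finset.prod_eq_single j (by intro i _ hij; simp [hij]) (by simp)] at hj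
  simpa [div_eq_one] using hj

/-- A vector of monomial values at a torus point is nonzero when there is at least one monomial. -/
theorem monomial_values_ne_zero {F ι : Type*} [Field F] [Fintype ι] {A : Finset (ι → ℕ)}
    (hA : A.Nonempty) (α : ι → Fˣ) :
    (fun a : {x // x ∈ A} => ∏ i, (α i : F) ^ (a : ι → ℕ) i) ≠ 0 := by
  obtain ⟨a, ha⟩ := hA
  intro h
  have h0 := congrFun h ⟨a, ha⟩
  simp [Finset.prod_eq_zero_iff] at h0

/-- Vectors of monomial values at distinct torus points are not proportional when the exponent
differences generate the character lattice. -/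
theorem monomial_values_ne_smul {F ι : Type*} [Field F] [Fintype ι] (A : Finset (ι → ℕ))
    (hgen : AddSubgroup.closure
        {v : ι → ℤ | ∃ a ∈ A, ∃ b ∈ A, v = fun i => (a i : ℤ) - (b i : ℤ)} = ⊤)
    (α β : ι → Fˣ) (hαβ : α ≠ β) (c : F) :
    (fun a : {x // x ∈ A} => ∏ i, (α i : F) ^ (a : ι → ℕ) i)
      ≠ c • (fun a : {x // x ∈ A} => ∏ i, (β i : F) ^ (a : ι → ℕ) i) := by
  intro h
  refine hαβ (eq_of_monomial_ratios_eq (A : Set (ι → ℕ)) hgen α β fun a ha b hb => ?_)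
  have h1 := congrFun h ⟨a, ha⟩
  have h2 := congrFun h ⟨b, hb⟩
  simp only [Pi.smul_apply, smul_eq_mul] at h1 h2
  ext
  push_cast
  rw [h1, h2]
  ring

/-- If the differences `{a − a′ : a, a′ ∈ A}` generate `ℤ^m` as a group,
then for any two distinct points `α, β ∈ (𝔽_q^*)^m` the evaluation vectors `(α^a)_{a∈A}`
and `(β^a)_{a∈A}` in `𝔽_q^A` are nonzero and neither is a scalar multiple of the other;
in particular they are linearly independent. -/
theorem stmt18 (F : Type) [Field F] [Fintype F] (m : ℕ) (A : Finset (Fin m → ℕ))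
    (hgen : AddSubgroup.closure
        {v : Fin m → ℤ | ∃ a ∈ A, ∃ b ∈ A, v = fun i => (a i : ℤ) - (b i : ℤ)} = ⊤)
    (α β : Fin m → Fˣ) (hαβ : α ≠ β) :
    (fun a : {x // x ∈ A} => ∏ i, (α i : F) ^ (a : Fin m → ℕ) i) ≠ 0 ∧
    (fun a : {x // x ∈ A} => ∏ i, (β i : F) ^ (a : Fin m → ℕ) i) ≠ 0 ∧
    (∀ c : F, (fun a : {x // x ∈ A} => ∏ i, (α i : F) ^ (a : Fin m → ℕ) i)
        ≠ c • (fun a : {x // x ∈ A} => ∏ i, (β i : F) ^ (a : Fin m → ℕ) i)) ∧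
    (∀ c : F, (fun a : {x // x ∈ A} => ∏ i, (β i : F) ^ (a : Fin m → ℕ) i)
        ≠ c • (fun a : {x // x ∈ A} => ∏ i, (α i : F) ^ (a : Fin m → ℕ) i)) ∧
    LinearIndependent F
      ![(fun a : {x // x ∈ A} => ∏ i, (α i : F) ^ (a : Fin m → ℕ) i),
        (fun a : {x // x ∈ A} => ∏ i, (β i : F) ^ (a : Fin m → ℕ) i)] := by
  have hA : A.Nonempty := by
    rw [Finset.nonempty_iff_ne_empty]
    rintro rfl
    exact hαβ (eq_of_monomial_ratios_eq _ hgen α β (by simp))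
  have h1 := monomial_values_ne_zero hA α
  have h4 := monomial_values_ne_smul A hgen β α hαβ.symm
  exact ⟨h1, monomial_values_ne_zero hA β, monomial_values_ne_smul A hgen α β hαβ, h4,
    (LinearIndependent.pair_iff' h1).2 fun c => (h4 c).symm⟩
end
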